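/- arXiv:2112.00070 — 2 statements merged into one kernel-verified Lean document; each statement's English description precedes it below -/
import Mathlib

section
/- Let G be a 2-connected graph on n ≥ 3 vertices, let k ≥ 4 and s ≥ 2 be integers, and write n-2 = r(k-3) + t with 0 ≤ t ≤ k-4. If N_s(G) > r·C(k-1, s) + C(t+2, s), then every edge of G lies on a cycle of length at least k. -/
/-- A graph is 2-connected if it has at least 3 vertices and remains connected
after deleting any single vertex. -/
def TwoConnected {V : Type*} (G : SimpleGraph V) : Prop :=
  3 ≤ Nat.card V ∧ ∀ v : V, (G.induce {w : V | w ≠ v}).Connected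

namespace KL

section Numeric

/-- Convexity of binomial coefficients. -/
lemma cv (J : ℕ) : ∀ (n a b e : ℕ), a = e + n → a ≤ b + n → 
    Nat.choose a J + Nat.choose b J ≤ Nat.choose (b + n) J + Nat.choose e J := by
  rcases J with _ | J
  · intros; simp
  intro n
  induction n with
  | zero => intro a b e h _; subst h; simp [add_comm]
  | succ n ih =>
    intro a b e h h2
    subst h
    have h1 := ih (e + n) b e rfl (by omega)
    have e1 : Nat.choose (e + (n+1)) (J+1) = Nat.choose (e+n) J + Nat.choose (e+n) (J+1) := by
      rw [← add_assoc, Nat.choose_succ_succ]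
    have e2 : Nat.choose (b + (n+1)) (J+1) = Nat.choose (b+n) J + Nat.choose (b+n) (J+1) := by
      rw [← add_assoc, Nat.choose_succ_succ]
    have e3 : Nat.choose (e+n) J ≤ Nat.choose (b+n) J := Nat.choose_le_choose _ (by omega)
    omega

lemma cv' (J a b c e : ℕ) (h : a + b = c + e) (ha : a ≤ c) (hb : b ≤ c) :
    Nat.choose a J + Nat.choose b J ≤ Nat.choose c J + Nat.choose e J := by
  obtain ⟨n, rfl⟩ : ∃ n, c = b + n := ⟨c - b, by omega⟩
  exact cv J n a b e (by omega) (by omega)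

lemma cv2 (J b x y : ℕ) (h : 2 * b ≤ x + y) :
    2 * Nat.choose b J ≤ Nat.choose x J + Nat.choose y J := by
  wlog hxy : y ≤ x generalizing x y
  · have := this y x (by omega) (by omega); omega
  by_cases hy : b ≤ y
  · have h1 : Nat.choose b J ≤ Nat.choose x J := Nat.choose_le_choose _ (by omega)
    have h2 : Nat.choose b J ≤ Nat.choose y J := Nat.choose_le_choose _ (by omega)
    omega
  · have h1 := cv' J b b (2*b-y) y (by omega) (by omega) (by omega)
    have h2 : Nat.choose (2*b-y) J ≤ Nat.choose x J := Nat.choose_le_choose _ (by omega)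
    omega

/-- The extremal function. -/
def gf (o d J m : ℕ) : ℕ := (m / d) * Nat.choose (d + o) J + Nat.choose (m % d + o) J

lemma gf_super (o d J a b : ℕ) (hd : 1 ≤ d) :
    gf o d J a + gf o d J b ≤ gf o d J (a + b) + Nat.choose o J := by
  unfold gf
  have ha := Nat.mod_lt a hd
  have hb := Nat.mod_lt b hd
  by_cases h : a % d + b % d < d
  · have h1 : (a + b) / d = a / d + b / d := by
      rw [Nat.add_div (by omega)]; simp; omega
    have h2 : (a + b) % d = a % d + b % d := by
      rw [Nat.add_mod, Nat.mod_eq_of_lt h]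
    rw [h1, h2, add_mul]
    have := cv' J (a % d + o) (b % d + o) (a % d + b % d + o) o (by omega) (by omega) (by omega)
    omega
  · have h1 : (a + b) / d = a / d + b / d + 1 := by
      rw [Nat.add_div (by omega)]; simp; omega
    have h2 : (a + b) % d = a % d + b % d - d := by
      rw [Nat.add_mod, Nat.mod_eq_sub_mod (by omega), Nat.mod_eq_of_lt (by omega)]
    rw [h1, h2, add_mul, add_mul]
    have := cv' J (a % d + o) (b % d + o) (d + o) (a % d + b % d - d + o)
      (by omega) (by omega) (by omega)
    omega

lemma gf_small (o d J m : ℕ) (hd : 1 ≤ d) (hm : m ≤ d) :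
    Nat.choose (m + o) J ≤ gf o d J m := by
  unfold gf
  rcases hm.lt_or_eq with h | h
  · rw [Nat.div_eq_of_lt h, Nat.mod_eq_of_lt h]; omega
  · subst h; rw [Nat.div_self (by omega)]; omega

lemma lift_aux (j B : ℕ) (q' n h : ℕ) (hB : B ≤ h) :
    Nat.choose h (j+1) + (q' + n) * Nat.choose B j ≤
      Nat.choose (h + n) (j+1) + q' * Nat.choose B j := by
  induction n with
  | zero => simp
  | succ n ih =>
    have e2 : Nat.choose (h + (n+1)) (j+1) = Nat.choose (h+n) j + Nat.choose (h+n) (j+1) := by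
      rw [← add_assoc, Nat.choose_succ_succ]
    have e3 : Nat.choose B j ≤ Nat.choose (h+n) j := Nat.choose_le_choose _ (by omega)
    have : (q' + (n+1)) * Nat.choose B j = (q' + n) * Nat.choose B j + Nat.choose B j := by ring
    omega

lemma lift (j B h q h' q' : ℕ) (hB : B ≤ h) (hh : h ≤ h') (he : h + q = h' + q') :
    Nat.choose h (j+1) + q * Nat.choose B j ≤ Nat.choose h' (j+1) + q' * Nat.choose B j := by
  have := lift_aux j B q' (h' - h) h hB
  rwa [show q' + (h' - h) = q by omega, show h + (h' - h) = h' by omega] at this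

lemma choose_sum (d j : ℕ) : ∑ i ∈ Finset.range d, Nat.choose i j = Nat.choose d (j+1) := by
  induction d with
  | zero => simp
  | succ d ih => rw [Finset.sum_range_succ, ih, Nat.choose_succ_succ']; omega

lemma period (d b j : ℕ) (hb : 2 * b + 1 ≤ d) : d * Nat.choose b j ≤ Nat.choose d (j+1) := by
  have h1 := choose_sum d j
  have h2 : ∑ i ∈ Finset.range d, Nat.choose (d - 1 - i) j = Nat.choose d (j+1) := by
    rw [← h1]; exact Finset.sum_range_reflect (fun i => Nat.choose i j) d
  have h3 : ∑ i ∈ Finset.range d, 2 * Nat.choose b j ≤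
      ∑ i ∈ Finset.range d, (Nat.choose i j + Nat.choose (d - 1 - i) j) := by
    apply Finset.sum_le_sum
    intro i hi
    have := Finset.mem_range.1 hi
    exact cv2 j b _ _ (by omega)
  rw [Finset.sum_add_distrib, h1, h2, Finset.sum_const, Finset.card_range, smul_eq_mul] at h3
  nlinarith

lemma base1 (d b j : ℕ) (hb : 2 * b + 1 ≤ d) :
    Nat.choose (d - b) (j+1) + (b + b) * Nat.choose b j ≤
      Nat.choose d (j+1) + Nat.choose b (j+1) := by
  have key : ∀ c, c ≤ b → Nat.choose (d - c) (j+1) + (c + c) * Nat.choose b j ≤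
      Nat.choose d (j+1) + Nat.choose c (j+1) := by
    intro c
    induction c with
    | zero => intro _; simp
    | succ c ih =>
      intro hc
      have h1 := ih (by omega)
      have e1 : Nat.choose (d - c) (j+1) = Nat.choose (d-(c+1)) j + Nat.choose (d-(c+1)) (j+1) := by
        rw [show d - c = d - (c+1) + 1 by omega, Nat.choose_succ_succ]
      have e2 := Nat.choose_succ_succ c j
      have h2 := cv2 j b (d-(c+1)) c (by omega)
      have : (c+1 + (c+1)) * Nat.choose b j = (c + c) * Nat.choose b j + 2 * Nat.choose b j := by ring
      simp only [Nat.succ_eq_add_one] at *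
      omega
  exact key b le_rfl

lemma base2 (b j t : ℕ) : Nat.choose b (j+1) + t * Nat.choose b j ≤
      b * Nat.choose b j + Nat.choose t (j+1) := by
  rcases le_total b t with h | h
  · have := lift j b b t t b le_rfl h (by omega)
    omega
  · -- t ≤ b
    obtain ⟨n, rfl⟩ : ∃ n, b = t + n := ⟨b - t, by omega⟩
    have : ∀ k ≤ n, Nat.choose (t + k) (j+1) ≤ k * Nat.choose (t+n) j + Nat.choose t (j+1) := by
      intro k
      induction k with
      | zero => intro _; simp
      | succ k ih =>
        intro hk
        have h1 := ih (by omega)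
        have e2 : Nat.choose (t + (k+1)) (j+1) = Nat.choose (t+k) j + Nat.choose (t+k) (j+1) := by
          rw [← add_assoc, Nat.choose_succ_succ]
        have e3 : Nat.choose (t+k) j ≤ Nat.choose (t+n) j := Nat.choose_le_choose _ (by omega)
        have : (k+1) * Nat.choose (t+n) j = k * Nat.choose (t+n) j + Nat.choose (t+n) j := by ring
        omega
    have := this n le_rfl
    have e : (t+n) * Nat.choose (t+n) j = t * Nat.choose (t+n) j + n * Nat.choose (t+n) j := by ring
    omega

lemma final_num (d b j m : ℕ) (hb : 2 * b + 1 ≤ d) (hm : d ≤ m) :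
    Nat.choose (d - b) (j+1) + (m - d + b) * Nat.choose b j ≤ gf 0 d (j+1) m := by
  obtain ⟨r, t, ht, rfl⟩ : ∃ r t, t < d ∧ m = (r + 1) * d + t := by
    refine ⟨m / d - 1, m % d, Nat.mod_lt _ (by omega), ?_⟩
    have h1 : 1 ≤ m / d := (Nat.one_le_div_iff (by omega)).2 hm
    rw [Nat.sub_add_cancel h1]
    exact (Nat.div_add_mod' m d).symm
  have e1 : ((r + 1) * d + t) / d = r + 1 := by
    rw [mul_comm, Nat.mul_add_div (by omega), Nat.div_eq_of_lt ht]
  have e2 : ((r + 1) * d + t) % d = t := by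
    rw [mul_comm, Nat.mul_add_mod, Nat.mod_eq_of_lt ht]
  unfold gf
  rw [e1, e2]
  simp only [add_zero]
  have e3 : (r + 1) * d + t - d + b = r * d + t + b := by
    have : (r+1) * d = r * d + d := by ring
    omega
  rw [e3]
  have h1 := base1 d b j hb
  have h2 := base2 b j t
  have h3 := Nat.mul_le_mul_left r (period d b j hb)
  nlinarith

end Numeric

section Kelmans
variable {V : Type*}

/-- The Kelmans shift of `G` from `u` to `v`. -/
def kel (G : SimpleGraph V) (u v : V) : SimpleGraph V where
  Adj a b := (G.Adj a b ∧ (a = u → b = v ∨ G.Adj v b) ∧ (b = u → a = v ∨ G.Adj v a)) ∨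
    (a = v ∧ b ≠ u ∧ b ≠ v ∧ G.Adj u b) ∨ (b = v ∧ a ≠ u ∧ a ≠ v ∧ G.Adj u a)
  symm := ⟨by
    intro a b h
    rcases h with h | h | h
    · exact Or.inl ⟨h.1.symm, h.2.2, h.2.1⟩
    · exact Or.inr (Or.inr h)
    · exact Or.inr (Or.inl h)⟩
  loopless := ⟨by
    intro a h
    rcases h with h | h | h
    · exact G.loopless.irrefl a h.1
    · exact h.2.2.1 h.1
    · exact h.2.2.1 h.1⟩

variable {G : SimpleGraph V} {u v : V}

lemma kel_ne {a b : V} (h : (kel G u v).Adj a b) (ha : a ≠ v) (hb : b ≠ v) : G.Adj a b := by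
  rcases h with h | h | h
  · exact h.1
  · exact absurd h.1 ha
  · exact absurd h.1 hb

lemma kel_u {b : V} (huv : G.Adj u v) (h : (kel G u v).Adj u b) :
    G.Adj u b ∧ (b = v ∨ G.Adj v b) := by
  rcases h with h | h | h
  · exact ⟨h.1, h.2.1 rfl⟩
  · exact absurd h.1 huv.ne
  · exact absurd rfl h.2.1

lemma kel_v {b : V} (h : (kel G u v).Adj v b) : G.Adj v b ∨ (b ≠ u ∧ G.Adj u b) := by
  rcases h with h | h | h
  · exact Or.inl h.1
  · exact Or.inr ⟨h.2.1, h.2.2.2⟩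
  · exact absurd rfl h.2.2.1

lemma kel_vu (huv : G.Adj u v) : (kel G u v).Adj v u :=
  Or.inl ⟨huv.symm, fun h => absurd h huv.ne', fun _ => Or.inl rfl⟩

lemma kel_of_v {b : V} (huv : G.Adj u v) (h : G.Adj v b) : (kel G u v).Adj v b :=
  Or.inl ⟨h, fun h => absurd h huv.ne', fun _ => Or.inl rfl⟩

lemma kel_of_u {b : V} (hb : b ≠ v) (h : G.Adj u b) : (kel G u v).Adj v b :=
  Or.inr (Or.inl ⟨rfl, h.ne', hb, h⟩)

lemma kel_of_ne {a b : V} (h : G.Adj a b) (ha : a ≠ u) (hb : b ≠ u) : (kel G u v).Adj a b :=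
  Or.inl ⟨h, fun h => absurd h ha, fun h => absurd h hb⟩

lemma kel_of_common {b : V} (huv : G.Adj u v) (h : G.Adj u b) (h' : G.Adj v b) : (kel G u v).Adj u b :=
  Or.inl ⟨h, fun _ => Or.inr h', fun e => absurd e h.ne'⟩

lemma chain_of_kel : ∀ (l : List V), l.IsChain (kel G u v).Adj → v ∉ l → l.IsChain G.Adj
  | [], _, _ => List.IsChain.nil
  | [a], _, _ => List.IsChain.singleton a
  | a :: b :: l, h, hv => by
    rw [List.isChain_cons_cons] at h ⊢
    simp only [List.mem_cons, not_or] at hv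
    exact ⟨kel_ne h.1 (Ne.symm hv.1) (Ne.symm hv.2.1),
      chain_of_kel (b :: l) h.2 (by simp [hv.2.1, hv.2.2])⟩

lemma chain_rev {l : List V} : l.reverse.IsChain G.Adj ↔ l.IsChain G.Adj := by
  rw [List.isChain_reverse]
  simp only [G.adj_comm]

/-- Conclusion of the path lemma. -/
def PC (G : SimpleGraph V) (u v : V) (l : List V) : Prop :=
  ∃ l' : List V, l'.Nodup ∧ l'.IsChain G.Adj ∧ l.length ≤ l'.length ∧
    (∀ a ∈ l', a ∈ l ∨ a = u) ∧ (l.head? ≠ some u → l'.head? = l.head?) ∧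
    (l.getLast? ≠ some u → l'.getLast? = l.getLast?)

lemma PC_rev {l : List V} (h : PC G u v l.reverse) : PC G u v l := by
  obtain ⟨l', h1, h2, h3, h4, h5, h6⟩ := h
  refine ⟨l'.reverse, by simpa using h1, chain_rev.2 h2, by simpa using h3, ?_, ?_, ?_⟩
  · intro a ha
    have := h4 a (by simpa using ha)
    simpa using this
  · simpa using h6
  · simpa using h5

lemma kel_path_main (huv : G.Adj u v) (L R : List V) (hn : (L ++ v :: R).Nodup)
    (hc : (L ++ v :: R).IsChain (kel G u v).Adj) (hu : u ∉ L) : PC G u v (L ++ v :: R) := by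
  have hne : u ≠ v := huv.ne
  have hvL : v ∉ L := by
    intro h; rw [List.nodup_append] at hn; exact hn.2.2 v h v (by simp) rfl
  have hvR : v ∉ R := by
    rw [List.nodup_append] at hn
    exact (List.nodup_cons.1 hn.2.1).1
  rw [List.isChain_append, List.isChain_cons] at hc
  obtain ⟨hcL, ⟨hvβ, hcR⟩, hα⟩ := hc
  simp only [List.head?_cons, Option.mem_def, Option.some.injEq, forall_eq'] at hα hvβ
  have gL := chain_of_kel L hcL hvL
  by_cases Pα : ∀ a, L.getLast? = some a → G.Adj v a
  · by_cases Pβ : ∀ b, R.head? = some b → G.Adj v b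
    · refine ⟨L ++ v :: R, hn, ?_, le_rfl, fun a h => Or.inl h, fun _ => rfl, fun _ => rfl⟩
      rw [List.isChain_append, List.isChain_cons]
      refine ⟨gL, ⟨fun b hb => Pβ b hb, chain_of_kel R hcR hvR⟩, ?_⟩
      simp only [List.head?_cons, Option.mem_def, Option.some.injEq, forall_eq']
      exact fun a ha => (Pα a ha).symm
    · push Not at Pβ
      obtain ⟨β, hβ, hnβ⟩ := Pβ
      have huβ : β ≠ u ∧ G.Adj u β := (kel_v (hvβ β hβ)).resolve_left hnβ
      by_cases huR : u ∈ R
      · obtain ⟨R1, R2, rfl⟩ := List.append_of_mem huR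
        rw [List.isChain_append, List.isChain_cons] at hcR
        obtain ⟨c1, ⟨c2, c3⟩, c4⟩ := hcR
        simp only [List.mem_append, List.mem_cons, not_or] at hvR
        have g1 := chain_of_kel R1 c1 hvR.1
        have g3 := chain_of_kel R2 c3 hvR.2.2
        refine ⟨L ++ v :: (R1.reverse ++ u :: R2), ?_, ?_, ?_, ?_, ?_, ?_⟩
        · refine (List.Perm.nodup_iff ?_).1 hn
          exact List.Perm.append_left _ (List.Perm.cons _
            (List.Perm.append_right _ (List.reverse_perm R1).symm))
        · rw [List.isChain_append, List.isChain_cons, List.isChain_append, List.isChain_cons, chain_rev]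
          simp only [List.head?_cons, Option.mem_def, Option.some.injEq, forall_eq',
            List.getLast?_reverse] at c4 c2 ⊢
          have hp : ∀ p, R1.getLast? = some p → G.Adj v p := by
            intro p hp
            have h := (kel_u huv (c4 p hp).symm).2
            have : p ∈ R1 := List.mem_of_getLast? hp
            exact h.resolve_left (fun e => hvR.1 (e ▸ this))
          have hR1 : R1 ≠ [] := by
            rintro rfl; simp at hβ; exact huβ.1 hβ.symm
          refine ⟨gL, ⟨?_, g1, ⟨fun b hb => (kel_u huv (c2 b hb)).1, g3⟩, ?_⟩, fun a ha => (Pα a ha).symm⟩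
          · intro b hb
            rw [List.head?_append_of_ne_nil _ (by simpa using hR1), List.head?_reverse] at hb
            exact hp b hb
          · intro a ha
            rw [List.head?_append_of_ne_nil _ hR1, ha] at hβ
            rw [Option.some.inj hβ]; exact huβ.2.symm
        · simp
        · intro a ha; left; simpa using ha
        · intro _; cases L <;> simp
        · intro _; simp [List.getLast?_append, List.getLast?_cons]
      · have gR := chain_of_kel R hcR hvR
        refine ⟨L ++ v :: u :: R, ?_, ?_, ?_, ?_, ?_, ?_⟩
        · have : (u :: (L ++ v :: R)).Nodup := List.nodup_cons.2 ⟨by simp [hu, huR, hne], hn⟩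
          refine (List.Perm.nodup_iff ?_).1 this
          rw [show L ++ v :: u :: R = (L ++ [v]) ++ u :: R by simp]
          refine List.Perm.trans ?_ List.perm_middle.symm
          simp
        · rw [List.isChain_append, List.isChain_cons, List.isChain_cons]
          simp only [List.head?_cons, Option.mem_def, Option.some.injEq, forall_eq']
          refine ⟨gL, ⟨huv.symm, ?_, gR⟩, fun a ha => (Pα a ha).symm⟩
          intro b hb; rw [hβ] at hb; rw [← Option.some.inj hb]; exact huβ.2
        · simp
        · intro a ha; simp at ha ⊢; tauto
        · intro _; cases L <;> simp
        · intro _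
          have : R ≠ [] := by rintro rfl; simp at hβ
          simp [List.getLast?_append, List.getLast?_cons, List.getLast?_eq_getLast_of_ne_nil this]
  · push Not at Pα
    obtain ⟨α, hα1, hnα⟩ := Pα
    have huα : α ≠ u ∧ G.Adj u α := (kel_v (hα α hα1).symm).resolve_left hnα
    have hL : L ≠ [] := by rintro rfl; simp at hα1
    have hjoin : ∀ a, L.getLast? = some a → G.Adj a u := by
      intro a ha; rw [hα1] at ha; rw [← Option.some.inj ha]; exact huα.2.symm
    by_cases huR : u ∈ R
    · obtain ⟨R1, R2, rfl⟩ := List.append_of_mem huR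
      rw [List.isChain_append, List.isChain_cons] at hcR
      obtain ⟨c1, ⟨c2, c3⟩, c4⟩ := hcR
      simp only [List.mem_append, List.mem_cons, not_or] at hvR
      have g1 := chain_of_kel R1 c1 hvR.1
      have g3 := chain_of_kel R2 c3 hvR.2.2
      simp only [List.head?_cons, Option.mem_def, Option.some.injEq, forall_eq'] at c4 c2
      have hp : ∀ p, R1.getLast? = some p → G.Adj p v := by
        intro p hp
        have h := (kel_u huv (c4 p hp).symm).2
        have : p ∈ R1 := List.mem_of_getLast? hp
        exact (h.resolve_left (fun e => hvR.1 (e ▸ this))).symm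
      have hpu : ∀ p, R1.getLast? = some p → G.Adj u p := fun p hp => (kel_u huv (c4 p hp).symm).1
      have hq : ∀ q, R2.head? = some q → G.Adj v q := by
        intro q hq
        have h := (kel_u huv (c2 q hq)).2
        have : q ∈ R2 := List.mem_of_head? hq
        exact (h.resolve_left (fun e => hvR.2.2 (e ▸ this)))
      by_cases Pβ : ∀ b, (R1 ++ u :: R2).head? = some b → G.Adj v b
      · refine ⟨L ++ u :: (R1.reverse ++ v :: R2), ?_, ?_, ?_, ?_, ?_, ?_⟩
        · refine (List.Perm.nodup_iff ?_).1 hn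
          refine List.Perm.append_left _ ?_
          refine List.Perm.trans (List.Perm.cons _ List.perm_middle) ?_
          refine List.Perm.trans (List.Perm.swap _ _ _) ?_
          refine List.Perm.cons _ ?_
          refine List.Perm.trans ?_ List.perm_middle.symm
          exact List.Perm.cons _ (List.Perm.append_right _ (List.reverse_perm R1).symm)
        · rw [List.isChain_append, List.isChain_cons, List.isChain_append, List.isChain_cons, chain_rev]
          simp only [List.head?_cons, Option.mem_def, Option.some.injEq, forall_eq',
            List.getLast?_reverse]
          refine ⟨gL, ⟨?_, g1, ⟨hq, g3⟩, ?_⟩, hjoin⟩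
          · intro b hb
            rcases eq_or_ne R1 [] with rfl | hR1
            · simp at hb; rw [← hb]; exact huv
            · rw [List.head?_append_of_ne_nil _ (by simpa using hR1), List.head?_reverse] at hb
              exact hpu b hb
          · intro a ha
            have hR1 : R1 ≠ [] := by rintro rfl; simp at ha
            apply SimpleGraph.Adj.symm
            apply Pβ
            rw [List.head?_append_of_ne_nil _ hR1, ha]
        · simp
        · intro a ha; left; simp at ha ⊢; tauto
        · intro _; cases L <;> simp at hL ⊢
        · intro h
          have : R2 ≠ [] := by rintro rfl; simp [List.getLast?_append, List.getLast?_cons] at h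
          simp [List.getLast?_append, List.getLast?_cons, List.getLast?_eq_getLast_of_ne_nil this]
      · push Not at Pβ
        obtain ⟨β, hβ, hnβ⟩ := Pβ
        have huβ : β ≠ u ∧ G.Adj u β := (kel_v (hvβ β hβ)).resolve_left hnβ
        have hR1 : R1 ≠ [] := by
            rintro rfl; simp at hβ; exact huβ.1 hβ.symm
        refine ⟨L ++ u :: (R1 ++ v :: R2), ?_, ?_, ?_, ?_, ?_, ?_⟩
        · refine (List.Perm.nodup_iff ?_).1 hn
          refine List.Perm.append_left _ ?_
          refine List.Perm.trans (List.Perm.cons _ List.perm_middle) ?_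
          refine List.Perm.trans (List.Perm.swap _ _ _) ?_
          exact List.Perm.cons _ List.perm_middle.symm
        · rw [List.isChain_append, List.isChain_cons, List.isChain_append, List.isChain_cons]
          simp only [List.head?_cons, Option.mem_def, Option.some.injEq, forall_eq']
          refine ⟨gL, ⟨?_, g1, ⟨hq, g3⟩, hp⟩, hjoin⟩
          intro b hb
          rw [List.head?_append_of_ne_nil _ hR1] at hb hβ
          rw [hβ] at hb; rw [← Option.some.inj hb]; exact huβ.2
        · simp
        · intro a ha; left; simp at ha ⊢; tauto
        · intro _; cases L <;> simp at hL ⊢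
        · intro h
          have : R2 ≠ [] := by rintro rfl; simp [List.getLast?_append, List.getLast?_cons] at h
          simp [List.getLast?_append, List.getLast?_cons, List.getLast?_eq_getLast_of_ne_nil this]
    · have gR := chain_of_kel R hcR hvR
      by_cases Pβ : ∀ b, R.head? = some b → G.Adj v b
      · refine ⟨L ++ u :: v :: R, ?_, ?_, ?_, ?_, ?_, ?_⟩
        · have : (u :: (L ++ v :: R)).Nodup := List.nodup_cons.2 ⟨by simp [hu, huR, hne], hn⟩
          exact (List.Perm.nodup_iff List.perm_middle.symm).1 this
        · rw [List.isChain_append, List.isChain_cons, List.isChain_cons]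
          simp only [List.head?_cons, Option.mem_def, Option.some.injEq, forall_eq']
          exact ⟨gL, ⟨huv, Pβ, gR⟩, hjoin⟩
        · simp
        · intro a ha; simp at ha ⊢; tauto
        · intro _; cases L <;> simp at hL ⊢
        · intro _
          simp [List.getLast?_append, List.getLast?_cons]
      · push Not at Pβ
        obtain ⟨β, hβ, hnβ⟩ := Pβ
        have huβ : β ≠ u ∧ G.Adj u β := (kel_v (hvβ β hβ)).resolve_left hnβ
        refine ⟨L ++ u :: R, ?_, ?_, ?_, ?_, ?_, ?_⟩
        · have h1 : (L ++ R).Nodup := (List.nodup_cons.1 ((List.Perm.nodup_iff List.perm_middle).1 hn)).2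
          have : (u :: (L ++ R)).Nodup := List.nodup_cons.2 ⟨by simp [hu, huR], h1⟩
          exact (List.Perm.nodup_iff List.perm_middle.symm).1 this
        · rw [List.isChain_append, List.isChain_cons]
          simp only [List.head?_cons, Option.mem_def, Option.some.injEq, forall_eq']
          refine ⟨gL, ⟨?_, gR⟩, hjoin⟩
          intro b hb; rw [hβ] at hb; rw [← Option.some.inj hb]; exact huβ.2
        · simp
        · intro a ha; simp at ha ⊢; tauto
        · intro _; cases L <;> simp at hL ⊢
        · intro _
          have : R ≠ [] := by rintro rfl; simp at hβ
          simp [List.getLast?_append, List.getLast?_cons, List.getLast?_eq_getLast_of_ne_nil this]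

lemma kel_path (huv : G.Adj u v) (l : List V) (hn : l.Nodup)
    (hc : l.IsChain (kel G u v).Adj) : PC G u v l := by
  by_cases hv : v ∈ l
  · obtain ⟨L, R, rfl⟩ := List.append_of_mem hv
    by_cases hu : u ∈ L
    · apply PC_rev
      have e : (L ++ v :: R).reverse = R.reverse ++ v :: L.reverse := by simp
      have hn' := List.nodup_reverse.2 hn
      have hc' := chain_rev.2 hc
      rw [e] at hn' hc' ⊢
      refine kel_path_main huv _ _ hn' hc' ?_
      intro h
      rw [List.nodup_append] at hn
      exact hn.2.2 u hu u (by simp at h; simp [h]) rfl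
    · exact kel_path_main huv L R hn hc hu
  · exact ⟨l, hn, chain_of_kel l hc hv, le_rfl, fun a h => Or.inl h, fun _ => rfl, fun _ => rfl⟩

end Kelmans
end KL

namespace KL

section Cliques
set_option linter.unusedSectionVars false
set_option linter.unusedVariables false
variable {V : Type*} [DecidableEq V]

open Classical in
/-- The finset of `j`-cliques inside `S`. -/
noncomputable def ncF (G : SimpleGraph V) (j : ℕ) (S : Finset V) : Finset (Finset V) :=
  (S.powersetCard j).filter (fun A => G.IsClique (A : Set V))

/-- The number of `j`-cliques inside `S`. -/
noncomputable def nc (G : SimpleGraph V) (j : ℕ) (S : Finset V) : ℕ := (ncF G j S).card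

variable {G : SimpleGraph V}

lemma mem_ncF {j : ℕ} {S A : Finset V} :
    A ∈ ncF G j S ↔ (A ⊆ S ∧ A.card = j) ∧ G.IsClique (A : Set V) := by
  simp [ncF, Finset.mem_powersetCard]

lemma nc_le (j : ℕ) (S : Finset V) : nc G j S ≤ Nat.choose S.card j := by
  rw [← Finset.card_powersetCard]
  exact Finset.card_le_card (fun A hA => Finset.mem_powersetCard.2 (mem_ncF.1 hA).1)

lemma nc_clique {j : ℕ} {S : Finset V} (h : G.IsClique (S : Set V)) :
    nc G j S = Nat.choose S.card j := by
  rw [← Finset.card_powersetCard]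
  unfold nc
  congr 1
  ext A
  rw [mem_ncF, Finset.mem_powersetCard]
  constructor
  · exact fun h => h.1
  · exact fun h1 => ⟨h1, h.subset (by exact_mod_cast h1.1)⟩

lemma nc_split {j : ℕ} {S T : Finset V} {u : V}
    (hT : ∀ w ∈ S, G.Adj u w → w ∈ T) :
    nc G (j+1) S ≤ nc G (j+1) (S.erase u) + nc G j T := by
  classical
  unfold nc
  rw [← Finset.card_filter_add_card_filter_not (s := ncF G (j+1) S) (fun A => u ∉ A)]
  apply Nat.add_le_add
  · apply Finset.card_le_card
    intro A hA
    rw [Finset.mem_filter, mem_ncF] at hA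
    rw [mem_ncF]
    exact ⟨⟨Finset.subset_erase.2 ⟨hA.1.1.1, hA.2⟩, hA.1.1.2⟩, hA.1.2⟩
  · apply Finset.card_le_card_of_injOn (fun A => A.erase u)
    · intro A hA
      simp only [not_not, Finset.coe_filter, Set.mem_ofPred_eq, mem_ncF] at hA
      simp only [Finset.mem_coe, mem_ncF]
      refine ⟨⟨?_, ?_⟩, ?_⟩
      · intro w hw
        rw [Finset.mem_erase] at hw
        exact hT w (hA.1.1.1 hw.2) (hA.1.2 hA.2 hw.2 (Ne.symm hw.1))
      · rw [Finset.card_erase_of_mem hA.2, hA.1.1.2]; rfl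
      · exact hA.1.2.subset (by exact_mod_cast Finset.erase_subset _ _)
    · intro A hA B hB h
      simp only [not_not, Finset.coe_filter, Set.mem_ofPred_eq] at hA hB
      simp only at h
      rw [← Finset.insert_erase hA.2, ← Finset.insert_erase hB.2, h]

lemma nc_union {j : ℕ} {P Q : Finset V}
    (h : ∀ a ∈ P, a ∉ Q → ∀ b ∈ Q, b ∉ P → ¬ G.Adj a b) :
    nc G j (P ∪ Q) + nc G j (P ∩ Q) ≤ nc G j P + nc G j Q := by
  unfold nc
  rw [← Finset.card_union_add_card_inter (ncF G j P) (ncF G j Q)]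
  apply Nat.add_le_add
  · apply Finset.card_le_card
    intro A hA
    rw [mem_ncF] at hA
    rw [Finset.mem_union, mem_ncF, mem_ncF]
    by_cases hP : A ⊆ P
    · exact Or.inl ⟨⟨hP, hA.1.2⟩, hA.2⟩
    · right
      refine ⟨⟨?_, hA.1.2⟩, hA.2⟩
      obtain ⟨b, hb, hbP⟩ := Finset.not_subset.1 hP
      have hbQ : b ∈ Q := (Finset.mem_union.1 (hA.1.1 hb)).resolve_left hbP
      intro a ha
      by_contra haQ
      have haP : a ∈ P := (Finset.mem_union.1 (hA.1.1 ha)).resolve_right haQ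
      exact h a haP haQ b hbQ hbP (hA.2 ha hb (by rintro rfl; exact haQ hbQ))
  · apply Finset.card_le_card
    intro A hA
    rw [mem_ncF, Finset.subset_inter_iff] at hA
    rw [Finset.mem_inter, mem_ncF, mem_ncF]
    tauto

lemma kel_clique_of_v {u v : V} (huv : G.Adj u v) {A : Finset V} (hA : G.IsClique (A : Set V))
    (hv : v ∈ A) : (kel G u v).IsClique (A : Set V) := by
  intro a ha b hb hab
  have h := hA ha hb hab
  refine Or.inl ⟨h, fun _ => ?_, fun _ => ?_⟩
  · by_cases e : b = v
    · exact Or.inl e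
    · exact Or.inr (hA (by exact_mod_cast hv) hb (Ne.symm e))
  · by_cases e : a = v
    · exact Or.inl e
    · exact Or.inr (hA (by exact_mod_cast hv) ha (Ne.symm e))

lemma nc_kel {j : ℕ} {S : Finset V} {u v : V} (huv : G.Adj u v) (hv : v ∈ S) :
    nc G j S ≤ nc (kel G u v) j S := by
  classical
  -- if a clique is not a clique of the shift then it has u, not v, and swapping works
  have key : ∀ A : Finset V, G.IsClique (A : Set V) → ¬ (kel G u v).IsClique (A : Set V) →
      u ∈ A ∧ v ∉ A ∧ (kel G u v).IsClique ((insert v (A.erase u) : Finset V) : Set V) ∧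
      ¬ G.IsClique ((insert v (A.erase u) : Finset V) : Set V) := by
    intro A hA hnA
    have hvA : v ∉ A := fun h => hnA (kel_clique_of_v huv hA h)
    have huA : u ∈ A := by
      by_contra huA
      apply hnA
      intro a ha b hb hab
      exact kel_of_ne (hA ha hb hab) (by rintro rfl; exact huA (by exact_mod_cast ha))
        (by rintro rfl; exact huA (by exact_mod_cast hb))
    refine ⟨huA, hvA, ?_, ?_⟩
    · intro a ha b hb hab
      simp only [Finset.coe_insert, Finset.coe_erase, Set.mem_insert_iff, Set.mem_sdiff,
        Finset.mem_coe, Set.mem_singleton_iff] at ha hb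
      rcases ha with rfl | ha
      · rcases hb with rfl | hb
        · exact absurd rfl hab
        · exact kel_of_u (Ne.symm hab) (hA huA hb.1 (Ne.symm hb.2))
      · rcases hb with rfl | hb
        · exact (kel_of_u hab (hA huA ha.1 (Ne.symm ha.2))).symm
        · exact kel_of_ne (hA ha.1 hb.1 hab) ha.2 hb.2
    · intro hc
      apply hnA
      have hadj : ∀ b ∈ A, b ≠ u → G.Adj v b := by
        intro b hb hbu
        exact hc (by simp) (by simp [hb, hbu]) (by rintro rfl; exact hvA hb)
      intro a ha b hb hab
      exact Or.inl ⟨hA ha hb hab, fun e => Or.inr (hadj b hb (by rintro rfl; exact hab e)),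
        fun e => Or.inr (hadj a ha (by rintro rfl; exact hab e.symm))⟩
  unfold nc
  apply Finset.card_le_card_of_injOn
    (fun A : Finset V => if (kel G u v).IsClique (A : Set V) then A else insert v (A.erase u))
  · intro A hA
    simp only [Finset.mem_coe, mem_ncF] at hA ⊢
    split_ifs with hk
    · exact ⟨hA.1, hk⟩
    · obtain ⟨h1, h2, h3, h4⟩ := key A hA.2 hk
      refine ⟨⟨?_, ?_⟩, h3⟩
      · exact Finset.insert_subset hv ((Finset.erase_subset _ _).trans hA.1.1)
      · rw [Finset.card_insert_of_notMem (fun h => h2 (Finset.mem_of_mem_erase h)),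
          Finset.card_erase_add_one h1, hA.1.2]
  · intro A hA B hB h
    simp only [Finset.mem_coe, mem_ncF] at hA hB
    simp only at h
    split_ifs at h with hk hk' hk'
    · exact h
    · obtain ⟨h1, h2, h3, h4⟩ := key B hB.2 hk'
      exact absurd (h ▸ hA.2) h4
    · obtain ⟨h1, h2, h3, h4⟩ := key A hA.2 hk
      exact absurd (h ▸ hB.2) h4
    · obtain ⟨h1, h2, -, -⟩ := key A hA.2 hk
      obtain ⟨h1', h2', -, -⟩ := key B hB.2 hk'
      have e : A.erase u = B.erase u := by
        have := congrArg (fun X => Finset.erase X v) h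
        rwa [Finset.erase_insert (fun h => h2 (Finset.mem_of_mem_erase h)),
          Finset.erase_insert (fun h => h2' (Finset.mem_of_mem_erase h))] at this
      rw [← Finset.insert_erase h1, ← Finset.insert_erase h1', e]

end Cliques

section Connectivity
set_option linter.unusedSectionVars false
set_option linter.unusedVariables false
variable {V : Type*} [DecidableEq V]

/-- Connectivity of the subgraph induced on `T`, via cuts. -/
def Conn (G : SimpleGraph V) (T : Finset V) : Prop :=
  ∀ A ⊆ T, A.Nonempty → (T \ A).Nonempty → ∃ a ∈ A, ∃ b ∈ T \ A, G.Adj a b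

/-- Being a path inside `S`. -/
def PathIn (G : SimpleGraph V) (S : Finset V) (l : List V) : Prop :=
  l.Nodup ∧ l.IsChain G.Adj ∧ ∀ a ∈ l, a ∈ S

variable {G : SimpleGraph V}

lemma conn_of_root {T : Finset V} {r : V} (hr : r ∈ T)
    (h : ∀ A ⊆ T, A.Nonempty → r ∉ A → ∃ a ∈ A, ∃ b ∈ T \ A, G.Adj a b) : Conn G T := by
  intro A hA hne hne'
  by_cases hrA : r ∈ A
  · obtain ⟨a, ha, b, hb, hab⟩ := h (T \ A) Finset.sdiff_subset hne' (by simp [hrA])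
    rw [Finset.sdiff_sdiff_eq_self hA] at hb
    exact ⟨b, hb, a, ha, hab.symm⟩
  · exact h A hA hne hrA

lemma PathIn.card_le {S : Finset V} {l : List V} (h : PathIn G S l) : l.length ≤ S.card := by
  rw [← List.toFinset_card_of_nodup h.1]
  exact Finset.card_le_card (fun a ha => h.2.2 a (List.mem_toFinset.1 ha))

lemma PathIn.mono {S T : Finset V} {l : List V} (h : PathIn G S l) (hST : S ⊆ T) : PathIn G T l :=
  ⟨h.1, h.2.1, fun a ha => hST (h.2.2 a ha)⟩

/-- `p` is the number of vertices of a longest path. -/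
def LP (G : SimpleGraph V) (T : Finset V) (p : ℕ) : Prop :=
  (∃ l, PathIn G T l ∧ l.length = p) ∧ ∀ l, PathIn G T l → l.length ≤ p

lemma exists_LP (G : SimpleGraph V) (T : Finset V) : ∃ p, LP G T p := by
  classical
  let P : ℕ → Prop := fun p => ∃ l, PathIn G T l ∧ l.length = p
  have h0 : P 0 := ⟨[], ⟨List.nodup_nil, List.IsChain.nil, by simp⟩, rfl⟩
  refine ⟨Nat.findGreatest P T.card, Nat.findGreatest_spec (P := P) (Nat.zero_le _) h0, ?_⟩
  intro l hl
  exact Nat.le_findGreatest hl.card_le ⟨l, hl, rfl⟩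

lemma LP_pos {T : Finset V} {p : ℕ} (h : LP G T p) (hT : T.Nonempty) : 1 ≤ p := by
  obtain ⟨v, hv⟩ := hT
  exact h.2 [v] ⟨by simp, by simp, by simpa using hv⟩

lemma LP_le {T : Finset V} {p : ℕ} (h : LP G T p) : p ≤ T.card := by
  obtain ⟨⟨l, hl, rfl⟩, -⟩ := h
  exact hl.card_le

lemma chain_side {T A : Finset V} (hno : ∀ a ∈ A, ∀ b ∈ T \ A, ¬ G.Adj a b) :
    ∀ l : List V, l.IsChain G.Adj → (∀ a ∈ l, a ∈ T) → (∀ a ∈ l, a ∈ A) ∨ (∀ a ∈ l, a ∈ T \ A)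
  | [], _, _ => Or.inl (by simp)
  | [a], _, h => by
    have := h a (by simp)
    by_cases ha : a ∈ A
    · left; simpa using ha
    · right; simp [this, ha]
  | a :: b :: l, hc, h => by
    rw [List.isChain_cons_cons] at hc
    have ha := h a (by simp)
    have ih := chain_side hno (b :: l) hc.2 (fun c hc => h c (by simp at hc ⊢; tauto))
    rcases ih with ih | ih
    · left
      have hb := ih b (by simp)
      have : a ∈ A := by
        by_contra hA
        exact hno b hb a (by simp [ha, hA]) hc.1.symm
      intro c hc
      rcases List.mem_cons.1 hc with rfl | hc
      · exact this
      · exact ih c hc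
    · right
      have hb := ih b (by simp)
      have : a ∈ T \ A := by
        by_contra hA
        exact hno a (by simp [ha] at hA; exact hA) b hb hc.1
      intro c hc
      rcases List.mem_cons.1 hc with rfl | hc
      · exact this
      · exact ih c hc

lemma conn_path {T : Finset V} (h : Conn G T) {a b : V} (ha : a ∈ T) (hb : b ∈ T) :
    ∃ l, PathIn G T l ∧ l.head? = some a ∧ l.getLast? = some b := by
  classical
  let A := T.filter (fun b => ∃ l, PathIn G T l ∧ l.head? = some a ∧ l.getLast? = some b)
  have haA : a ∈ A := by
    simp only [A, Finset.mem_filter]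
    exact ⟨ha, [a], ⟨by simp, by simp, by simpa using ha⟩, rfl, rfl⟩
  by_contra hcon
  have hbA : b ∈ T \ A := by
    simp only [A, Finset.mem_sdiff, Finset.mem_filter, not_and]
    exact ⟨hb, fun _ => hcon⟩
  obtain ⟨c, hc, e, he, hce⟩ := h A (Finset.filter_subset _ _) ⟨a, haA⟩ ⟨b, hbA⟩
  obtain ⟨hcT, l, hl, hla, hlc⟩ := Finset.mem_filter.1 hc
  obtain ⟨heT, heA⟩ := Finset.mem_sdiff.1 he
  apply heA
  refine Finset.mem_filter.2 ⟨heT, ?_⟩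
  by_cases hel : e ∈ l
  · obtain ⟨l1, l2, rfl⟩ := List.append_of_mem hel
    have e1 : l1 ++ e :: l2 = (l1 ++ [e]) ++ l2 := by simp
    rw [e1] at hl hla
    refine ⟨l1 ++ [e], ⟨(List.nodup_append.1 hl.1).1, (List.isChain_append.1 hl.2.1).1,
      fun a ha => hl.2.2 a (List.mem_append_left _ ha)⟩, ?_, by simp⟩
    rwa [List.head?_append_of_ne_nil _ (by simp)] at hla
  · refine ⟨l ++ [e], ⟨?_, ?_, ?_⟩, ?_, by simp⟩
    · rw [List.nodup_append]
      exact ⟨hl.1, by simp, fun a ha b hb => by simp at hb; subst hb; rintro rfl; exact hel ha⟩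
    · rw [List.isChain_append]
      refine ⟨hl.2.1, by simp, ?_⟩
      intro x hx y hy
      simp at hy; subst hy
      rw [hlc] at hx; simp at hx; subst hx; exact hce
    · intro x hx
      rcases List.mem_append.1 hx with hx | hx
      · exact hl.2.2 x hx
      · simp at hx; subst hx; exact heT
    · have : l ≠ [] := by rintro rfl; simp at hla
      rw [List.head?_append_of_ne_nil _ this]; exact hla

lemma kel_pathIn {T : Finset V} {u v : V} (huv : G.Adj u v) (hu : u ∈ T) {l : List V}
    (h : PathIn (kel G u v) T l) : ∃ l', PathIn G T l' ∧ l.length ≤ l'.length ∧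
    (l.head? ≠ some u → l'.head? = l.head?) ∧
    (l.getLast? ≠ some u → l'.getLast? = l.getLast?) := by
  obtain ⟨l', h1, h2, h3, h4, h5, h6⟩ := kel_path huv l h.1 h.2.1
  refine ⟨l', ⟨h1, h2, ?_⟩, h3, h5, h6⟩
  intro a ha
  rcases h4 a ha with h' | rfl
  · exact h.2.2 a h'
  · exact hu

lemma kel_conn {T : Finset V} {u v : V} (huv : G.Adj u v) (hv : v ∈ T)
    (h : Conn G T) : Conn (kel G u v) T := by
  apply conn_of_root hv
  intro A hA hne hvA
  by_cases huA : u ∈ A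
  · exact ⟨u, huA, v, by simp [hv, hvA], (kel_vu huv).symm⟩
  · obtain ⟨a, ha, b, hb, hab⟩ := h A hA hne ⟨v, by simp [hv, hvA]⟩
    have hau : a ≠ u := by rintro rfl; exact huA ha
    by_cases hbu : b = u
    · subst hbu
      exact ⟨a, ha, v, by simp [hv, hvA],
        (kel_of_u (by rintro rfl; exact hvA ha) hab.symm).symm⟩
    · exact ⟨a, ha, b, hb, kel_of_ne hab hau hbu⟩

lemma universal {T : Finset V} {v : V} (hv : v ∈ T) : ∀ (n : ℕ) (G : SimpleGraph V), Conn G T →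
    (∀ A : Finset V, A ⊆ T → (∀ w ∈ A, w ≠ v → G.Adj v w) → (∀ w ∈ T, G.Adj v w → w ∈ A) →
      v ∈ A → T.card ≤ A.card + n) →
    ∃ G' : SimpleGraph V, Conn G' T ∧ (∀ w ∈ T, w ≠ v → G'.Adj v w) ∧
      (∀ j, nc G j T ≤ nc G' j T) ∧
      (∀ l, PathIn G' T l → ∃ l', PathIn G T l' ∧ l.length ≤ l'.length) := by
  classical
  intro n
  induction n with
  | zero =>
    intro G hG hn
    refine ⟨G, hG, ?_, fun _ => le_rfl, fun l hl => ⟨l, hl, le_rfl⟩⟩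
    intro w hw hwv
    have := hn (T.filter (fun w => w = v ∨ G.Adj v w)) (Finset.filter_subset _ _)
      (by intro w hw hwv; rw [Finset.mem_filter] at hw; tauto)
      (by intro w hw hwv; rw [Finset.mem_filter]; tauto)
      (by rw [Finset.mem_filter]; tauto)
    have := Finset.eq_of_subset_of_card_le (Finset.filter_subset _ _) this
    rw [← this, Finset.mem_filter] at hw
    tauto
  | succ n ih =>
    intro G hG hn
    set A := T.filter (fun w => w = v ∨ G.Adj v w) with hA
    by_cases hne : (T \ A).Nonempty
    · have hvA : v ∈ A := by rw [hA, Finset.mem_filter]; tauto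
      obtain ⟨u, hu, b, hb, hub⟩ := hG A (Finset.filter_subset _ _) ⟨v, hvA⟩ hne
      rw [hA, Finset.mem_filter] at hu
      rw [hA, Finset.mem_sdiff, Finset.mem_filter, not_and, not_or] at hb
      have huv : G.Adj u v := by
        rcases hu.2 with rfl | h
        · exact absurd hub (hb.2 hb.1).2
        · exact h.symm
      obtain ⟨G', h1, h2, h3, h4⟩ := ih (kel G u v) (kel_conn huv hv hG) (by
        intro B hB hB1 hB2 hvB
        have : T.card ≤ A.card + (n + 1) := by
          apply hn A (Finset.filter_subset _ _)
          · intro w hw hwv; rw [hA, Finset.mem_filter] at hw; tauto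
          · intro w hw hwv; rw [hA, Finset.mem_filter]; tauto
          · exact hvA
        have h5 : insert b A ⊆ B := by
          intro w hw
          rcases Finset.mem_insert.1 hw with rfl | hw
          · exact hB2 _ hb.1 (kel_of_u (hb.2 hb.1).1 hub)
          · rw [hA, Finset.mem_filter] at hw
            rcases hw.2 with rfl | h
            · exact hvB
            · exact hB2 _ hw.1 (kel_of_v huv h)
        have h6 := Finset.card_le_card h5
        rw [Finset.card_insert_of_notMem (by rw [hA, Finset.mem_filter]; tauto)] at h6
        omega)
      refine ⟨G', h1, h2, fun j => (nc_kel huv hv).trans (h3 j), ?_⟩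
      intro l hl
      obtain ⟨l', hl', hle⟩ := h4 l hl
      obtain ⟨l'', hl'', hle', -, -⟩ := kel_pathIn huv hu.1 hl'
      exact ⟨l'', hl'', hle.trans hle'⟩
    · refine ⟨G, hG, ?_, fun _ => le_rfl, fun l hl => ⟨l, hl, le_rfl⟩⟩
      intro w hw hwv
      rw [Finset.not_nonempty_iff_eq_empty, Finset.sdiff_eq_empty_iff_subset] at hne
      have := hne hw
      rw [hA, Finset.mem_filter] at this
      tauto

lemma del_lemma {v : V} {a j : ℕ} : ∀ (n : ℕ) (T W : Finset V), W.card = n → W ⊆ T → v ∉ W →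
    (∀ w ∈ W, ∀ t ∈ T, G.Adj w t → t ∈ W ∨ t = v) → (∀ l, PathIn G W l → l.length ≤ a) →
    nc G (j+1) T ≤ nc G (j+1) (T \ W) + W.card * Nat.choose a j := by
  intro n
  induction n with
  | zero =>
    intro T W hW _ _ _ _
    rw [Finset.card_eq_zero] at hW
    subst hW; simp
  | succ n ih =>
    intro T W hW hWT hv hno hp
    have hne : W.Nonempty := Finset.card_pos.1 (by omega)
    obtain ⟨p, hLP⟩ := exists_LP G W
    have hp1 := LP_pos hLP hne
    obtain ⟨⟨l, hl, hlp⟩, hmax⟩ := hLP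
    rcases l with _ | ⟨w, l⟩
    · simp at hlp; omega
    have hw : w ∈ W := hl.2.2 w (by simp)
    have h1 : nc G (j+1) T ≤ nc G (j+1) (T.erase w) + nc G j (insert v l.toFinset) := by
      apply nc_split
      intro t ht hwt
      rcases hno w hw t ht hwt with h | h
      · by_contra hcon
        simp only [Finset.mem_insert, List.mem_toFinset, not_or] at hcon
        have : PathIn G W (t :: w :: l) := by
          refine ⟨List.nodup_cons.2 ⟨?_, hl.1⟩, ?_, ?_⟩
          · simp only [List.mem_cons, not_or]; exact ⟨hwt.ne', hcon.2⟩
          · rw [List.isChain_cons_cons]; exact ⟨hwt.symm, hl.2.1⟩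
          · intro x hx
            rcases List.mem_cons.1 hx with rfl | hx
            · exact h
            · exact hl.2.2 x hx
        have := hmax _ this
        simp at this hlp; omega
      · subst h; simp
    have h2 : nc G j (insert v l.toFinset) ≤ Nat.choose a j := by
      refine (nc_le _ _).trans (Nat.choose_le_choose _ ?_)
      have h3 := Finset.card_insert_le v l.toFinset
      have h4 := List.toFinset_card_le l
      have h5 := hp _ hl
      simp at h5; omega
    have h3 := ih (T.erase w) (W.erase w) (by rw [Finset.card_erase_of_mem hw, hW]; rfl)
      (Finset.erase_subset_erase _ hWT) (fun h => hv (Finset.mem_of_mem_erase h))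
      (by
        intro x hx t ht hxt
        have := hno x (Finset.mem_of_mem_erase hx) t (Finset.mem_of_mem_erase ht) hxt
        rcases this with h | h
        · left; exact Finset.mem_erase.2 ⟨(Finset.mem_erase.1 ht).1, h⟩
        · exact Or.inr h)
      (fun l hl => hp l (hl.mono (Finset.erase_subset _ _)))
    have e : T.erase w \ W.erase w = T \ W := by
      ext x; simp only [Finset.mem_sdiff, Finset.mem_erase]
      constructor
      · rintro ⟨⟨h1, h2⟩, h3⟩; exact ⟨h2, fun h => h3 ⟨h1, h⟩⟩
      · rintro ⟨h1, h2⟩; exact ⟨⟨by rintro rfl; exact h2 hw, h1⟩, fun h => h2 h.2⟩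
    rw [e, Finset.card_erase_of_mem hw, hW, Nat.add_sub_cancel] at h3
    rw [hW, add_mul, one_mul]
    omega

lemma tree_num (b1 a1 a2 m1 p w j : ℕ) (h2 : 2 * b1 + 1 ≤ a1) (h3 : a1 ≤ m1)
    (h6 : a1 + a2 + 1 ≤ p) (h7 : p ≤ m1 + 1 + w) (h8 : a2 ≤ a1) (h9 : 1 ≤ a2) :
    Nat.choose (a1 - b1 + 1) (j+1) + (m1 - a1 + b1) * Nat.choose (b1 + 1) j
      + w * Nat.choose a2 j ≤ Nat.choose (p - max a2 (b1+1)) (j+1) +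
        (m1 + 1 + w - p + max a2 (b1+1)) * Nat.choose (max a2 (b1+1)) j := by
  rcases le_total (b1+1) a2 with h | h
  · rw [max_eq_left h]
    have l1 := lift j (b1+1) (a1 - b1 + 1) (m1 - a1 + b1) (a1 + 1) (m1 - a1)
      (by omega) (by omega) (by omega)
    have l2 := lift j a2 (a1+1) (m1 - a1 + w) (p - a2) (m1 + 1 + w - p + a2)
      (by omega) (by omega) (by omega)
    have l3 := Nat.mul_le_mul_left (m1 - a1) (Nat.choose_le_choose j h)
    rw [add_mul] at l2
    omega
  · rw [max_eq_right h]
    have l2 := lift j (b1+1) (a1 - b1 +1) (m1 - a1 + b1 + w) (p - (b1+1)) (m1 + 1 + w - p + (b1+1))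
      (by omega) (by omega) (by omega)
    have l3 := Nat.mul_le_mul_left w (Nat.choose_le_choose j h)
    rw [add_mul] at l2
    omega

/-- Conclusion of the tree lemma. -/
def TC (G : SimpleGraph V) (T : Finset V) (p : ℕ) : Prop :=
  p = T.card ∨ ∃ b, 1 ≤ b ∧ 2 * b + 1 ≤ p ∧
    ∀ j, nc G (j+1) T ≤ Nat.choose (p - b) (j+1) + (T.card - p + b) * Nat.choose b j

lemma exists_comp {U : Finset V} {l : List V} (hl : PathIn G U l) (hne : l ≠ []) :
    ∃ C ⊆ U, (∀ a ∈ l, a ∈ C) ∧ Conn G C ∧ ∀ a ∈ C, ∀ b ∈ U \ C, ¬ G.Adj a b := by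
  classical
  let P : ℕ → Prop := fun n => ∃ C ⊆ U, C.card = n ∧ (∀ a ∈ l, a ∈ C) ∧
    ∀ a ∈ C, ∀ b ∈ U \ C, ¬ G.Adj a b
  have hP : ∃ n, P n := ⟨U.card, U, subset_rfl, rfl, hl.2.2, by simp⟩
  obtain ⟨C, hCU, hCn, hlC, hno⟩ := Nat.find_spec hP
  refine ⟨C, hCU, hlC, ?_, hno⟩
  have hmin : ∀ D ⊆ C, (C \ D).Nonempty → (∀ a ∈ l, a ∈ D) →
      ∃ a ∈ D, ∃ b ∈ C \ D, G.Adj a b := by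
    intro D hD hDne hlD
    by_contra hcon
    push Not at hcon
    have hlt : D.card < C.card := Finset.card_lt_card (Finset.ssubset_iff_subset_ne.2
      ⟨hD, by rintro rfl; simp at hDne⟩)
    rw [hCn] at hlt
    apply Nat.find_min hP hlt
    refine ⟨D, hD.trans hCU, rfl, hlD, ?_⟩
    intro a ha b hb
    by_cases hbC : b ∈ C
    · exact hcon a ha b (by simp [hbC]; exact (Finset.mem_sdiff.1 hb).2)
    · exact hno a (hD ha) b (by simp [hbC]; exact (Finset.mem_sdiff.1 hb).1)
  intro A hA hAne hAne'
  by_contra hcon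
  push Not at hcon
  rcases chain_side hcon l hl.2.1 hlC with h | h
  · obtain ⟨a, ha, b, hb, hab⟩ := hmin A hA hAne' h
    exact hcon a ha b hb hab
  · obtain ⟨a, ha, b, hb, hab⟩ := hmin (C \ A) Finset.sdiff_subset
      (by rwa [Finset.sdiff_sdiff_eq_self hA]) h
    rw [Finset.sdiff_sdiff_eq_self hA] at hb
    exact hcon b hb a ha hab.symm

lemma path_join {T X Y : Finset V} {v : V} {l1 l2 : List V} (hX : X ⊆ T) (hY : Y ⊆ T) (hv : v ∈ T)
    (hvX : v ∉ X) (hvY : v ∉ Y) (hXY : ∀ a ∈ l2, a ∉ l1) (huni : ∀ w ∈ T, w ≠ v → G.Adj v w)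
    (h1 : PathIn G X l1) (h2 : PathIn G Y l2) : PathIn G T (l2 ++ v :: l1) := by
  refine ⟨?_, ?_, ?_⟩
  · rw [List.nodup_append]
    refine ⟨h2.1, List.nodup_cons.2 ⟨fun h => hvX (h1.2.2 v h), h1.1⟩, ?_⟩
    intro a ha b hb
    rintro rfl
    rcases List.mem_cons.1 hb with rfl | hb
    · exact hvY (h2.2.2 _ ha)
    · exact hXY a ha hb
  · rw [List.isChain_append, List.isChain_cons]
    refine ⟨h2.2.1, ⟨?_, h1.2.1⟩, ?_⟩
    · intro b hb
      have := h1.2.2 b (List.mem_of_head? hb)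
      exact huni b (hX this) (by rintro rfl; exact hvX this)
    · intro b hb c hc
      simp at hc; subst hc
      have := h2.2.2 b (List.mem_of_getLast? hb)
      exact (huni b (hY this) (by rintro rfl; exact hvY this)).symm
  · intro a ha
    simp only [List.mem_append, List.mem_cons] at ha
    rcases ha with h | rfl | h
    · exact hY (h2.2.2 a h)
    · exact hv
    · exact hX (h1.2.2 a h)

lemma tree_uni {T : Finset V} {v : V} (hv : v ∈ T) (huni : ∀ w ∈ T, w ≠ v → G.Adj v w)
    (ih : ∀ (C : Finset V), C.card < T.card → C.Nonempty → Conn G C → ∀ p, LP G C p → TC G C p)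
    {p : ℕ} (hp : LP G T p) : TC G T p := by
  by_cases hpT : p = T.card
  · exact Or.inl hpT
  have hpT' : p < T.card := lt_of_le_of_ne (LP_le hp) hpT
  have hp1 := LP_pos hp ⟨v, hv⟩
  set U := T.erase v with hU
  have hUT : U ⊆ T := Finset.erase_subset _ _
  have hvU : v ∉ U := by simp [hU]
  have hUc : U.card + 1 = T.card := Finset.card_erase_add_one hv
  have hUne : U.Nonempty := Finset.card_pos.1 (by omega)
  obtain ⟨a1, ha1⟩ := exists_LP G U
  have ha1p := LP_pos ha1 hUne
  obtain ⟨⟨l1, hl1, hl1a⟩, hmax1⟩ := ha1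
  obtain ⟨C, hCU, hlC, hCconn, hCno⟩ := exists_comp hl1 (by rintro rfl; simp at hl1a; omega)
  have hl1C : PathIn G C l1 := ⟨hl1.1, hl1.2.1, hlC⟩
  have hLPC : LP G C a1 := ⟨⟨l1, hl1C, hl1a⟩, fun l hl => hmax1 l (hl.mono hCU)⟩
  have hvC : v ∉ C := fun h => hvU (hCU h)
  have ha1C := LP_le hLPC
  have hCc := Finset.card_le_card hCU
  set W := U \ C with hW
  have hWc : W.card + C.card = U.card := Finset.card_sdiff_add_card_eq_card hCU
  have hWU : W ⊆ U := Finset.sdiff_subset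
  have hvW : v ∉ W := fun h => hvU (hWU h)
  have hTW : T \ W = insert v C := by
    ext x
    simp only [hW, hU, Finset.mem_sdiff, Finset.mem_erase, Finset.mem_insert]
    constructor
    · rintro ⟨h1, h2⟩
      by_contra hcon
      push Not at hcon
      exact h2 ⟨⟨hcon.1, h1⟩, hcon.2⟩
    · rintro (rfl | h)
      · exact ⟨hv, fun h => h.1.1 rfl⟩
      · exact ⟨hUT (hCU h), fun h' => h'.2 h⟩
  have hdel : ∀ a, (∀ l, PathIn G W l → l.length ≤ a) → ∀ j, nc G (j+1) T ≤
      nc G (j+1) C + nc G j C + W.card * Nat.choose a j := by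
    intro a ha j
    have h1 := del_lemma (G := G) (v := v) (a := a) (j := j) W.card T W rfl (hWU.trans hUT) hvW (by
      intro w hw t ht hwt
      by_cases htv : t = v
      · exact Or.inr htv
      left
      have htU : t ∈ U := Finset.mem_erase.2 ⟨htv, ht⟩
      refine Finset.mem_sdiff.2 ⟨htU, fun htC => ?_⟩
      exact hCno t htC w hw hwt.symm) ha
    have h2 : nc G (j+1) (insert v C) ≤ nc G (j+1) C + nc G j C := by
      have := nc_split (G := G) (j := j) (S := insert v C) (T := C) (u := v) (by
        intro w hw hvw
        exact (Finset.mem_insert.1 hw).resolve_left hvw.ne')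
      rwa [Finset.erase_insert hvC] at this
    rw [hTW] at h1
    omega
  obtain ⟨a2, ha2W⟩ := exists_LP G W
  obtain ⟨⟨l2, hl2, hl2a⟩, hmax2⟩ := ha2W
  have hjoin : a1 + a2 + 1 ≤ p := by
    have := hp.2 _ (path_join hUT (hWU.trans hUT) hv hvU hvW (by
      intro a ha ha'
      exact (Finset.mem_sdiff.1 (hl2.2.2 a ha)).2 (hlC a ha')) huni hl1 hl2)
    simp at this; omega
  have ha21 : a2 ≤ a1 := by rw [← hl2a]; exact hmax1 _ (hl2.mono hWU)
  have hTc : T.card = C.card + 1 + W.card := by omega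
  rcases ih C (by omega) (Finset.card_pos.1 (by omega)) hCconn a1 hLPC with hfull | ⟨b1, hb1, hb1a, hbd⟩
  · -- full
    have hWne : W.Nonempty := Finset.card_pos.1 (by omega)
    have ha2p := LP_pos ⟨⟨l2, hl2, hl2a⟩, hmax2⟩ hWne
    right
    refine ⟨a2, ha2p, by omega, ?_⟩
    intro j
    have h1 := hdel a2 hmax2 j
    have h2 := nc_le (G := G) (j+1) C
    have h3 := nc_le (G := G) j C
    rw [← hfull] at h2 h3
    have h4 := Nat.choose_succ_succ' a1 j
    have h5 := lift j a2 (a1+1) W.card (p - a2) (T.card - p + a2) (by omega) (by omega) (by omega)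
    omega
  · right
    obtain ⟨a, haa, hap, ha1', hal⟩ : ∃ a, a ≤ a1 ∧ a1 + a + 1 ≤ p ∧ 1 ≤ a ∧
        (∀ l, PathIn G W l → l.length ≤ a) := by
      by_cases hWne : W.Nonempty
      · exact ⟨a2, ha21, hjoin, LP_pos ⟨⟨l2, hl2, hl2a⟩, hmax2⟩ hWne, hmax2⟩
      · refine ⟨1, ha1p, ?_, le_rfl, ?_⟩
        · by_cases hfull : a1 = C.card
          · rw [Finset.not_nonempty_iff_eq_empty] at hWne
            have : W.card = 0 := by simp [hWne]
            omega
          · have : ∃ z ∈ C, z ∉ l1 := by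
              by_contra hcon
              push Not at hcon
              have h1 : C ⊆ l1.toFinset := fun z hz => List.mem_toFinset.2 (hcon z hz)
              have h2 := Finset.card_le_card h1
              have h3 := List.toFinset_card_le l1
              omega
            obtain ⟨z, hz, hzl⟩ := this
            have := hp.2 _ (path_join hUT hUT hv hvU hvU (l2 := [z]) (by simpa using hzl) huni hl1
              ⟨by simp, by simp, by simpa using hCU hz⟩)
            simp at this; omega
        · intro l hl
          have := hl.card_le
          rw [Finset.not_nonempty_iff_eq_empty] at hWne
          simp [hWne] at this
          simp [this]
    refine ⟨max a (b1+1), by omega, by omega, ?_⟩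
    intro j
    rcases j with _ | j
    · have := nc_le (G := G) 1 T
      simp at this ⊢
      omega
    · have h1 := hdel a hal (j+1)
      have h2 := hbd (j+1)
      have h3 := hbd j
      have h4 := Nat.choose_succ_succ' (a1-b1) (j+1)
      have h5 := Nat.choose_succ_succ' b1 j
      have h6 := tree_num b1 a1 a C.card p W.card (j+1) hb1a ha1C hap (by omega) haa ha1'
      rw [← hTc, h5, mul_add] at h6
      omega

lemma tree : ∀ (n : ℕ) (G : SimpleGraph V) (T : Finset V), T.card = n → T.Nonempty → Conn G T →
    ∀ p, LP G T p → TC G T p := by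
  intro n
  induction n using Nat.strong_induction_on with
  | _ n ih =>
  intro G T hT hne hconn p hp
  obtain ⟨v, hv⟩ := hne
  obtain ⟨G', h1, h2, h3, h4⟩ := universal hv T.card G hconn (by intros; omega)
  obtain ⟨p', hp'⟩ := exists_LP G' T
  have hpp : p' ≤ p := by
    obtain ⟨⟨l, hl, hla⟩, -⟩ := hp'
    obtain ⟨l', hl', hle⟩ := h4 l hl
    have := hp.2 l' hl'
    omega
  have hpT := LP_le hp
  have := tree_uni hv h2 (fun C hC hne hc p hp => ih C.card (by omega) G' C rfl hne hc p hp) hp'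
  rcases this with h | ⟨b, hb, hb1, hb2⟩
  · left; omega
  · right
    refine ⟨b, hb, by omega, ?_⟩
    intro j
    refine ((h3 _).trans (hb2 j)).trans ?_
    exact lift j b _ _ _ _ (by omega) (by omega) (by omega)

lemma lemmaP (d : ℕ) (hd : 1 ≤ d) (G : SimpleGraph V) (j : ℕ) : ∀ (n : ℕ) (S : Finset V),
    S.card = n → (∀ l, PathIn G S l → l.length ≤ d) → nc G j S ≤ gf 0 d j S.card := by
  rcases j with _ | j
  · intro n S _ _
    have := nc_le (G := G) 0 S
    unfold gf
    simp only [Nat.choose_zero_right] at this ⊢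
    exact this.trans (Nat.le_add_left _ _)
  intro n
  induction n using Nat.strong_induction_on with
  | _ n ih =>
  intro S hS hp
  by_cases hSd : S.card ≤ d
  · exact (nc_le _ _).trans (gf_small 0 d (j+1) _ hd hSd)
  by_cases hc : Conn G S
  · obtain ⟨p, hLP⟩ := exists_LP G S
    have hpd : p ≤ d := by
      obtain ⟨⟨l, hl, hla⟩, -⟩ := hLP
      have := hp l hl
      omega
    rcases tree _ G S rfl (Finset.card_pos.1 (by omega)) hc p hLP with h | ⟨b, hb, hb1, hb2⟩
    · omega
    · refine (hb2 j).trans ?_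
      refine le_trans ?_ (final_num d b j S.card (by omega) (by omega))
      exact lift j b _ _ _ _ (by omega) (by omega) (by omega)
  · unfold Conn at hc
    push Not at hc
    obtain ⟨A, hA, hne, hne', hno⟩ := hc
    have h1 := Finset.card_pos.2 hne
    have h2 := Finset.card_pos.2 hne'
    have h3 := Finset.card_sdiff_add_card_eq_card hA
    have i1 := ih A.card (by omega) A rfl (fun l hl => hp l (hl.mono hA))
    have i2 := ih (S \ A).card (by omega) (S \ A) rfl (fun l hl => hp l (hl.mono Finset.sdiff_subset))
    have h4 := nc_union (G := G) (j := j+1) (P := A) (Q := S \ A)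
      (fun a ha _ b hb _ => hno a ha b hb)
    rw [Finset.union_sdiff_of_subset hA] at h4
    have h5 := gf_super 0 d (j+1) A.card (S \ A).card hd
    rw [add_comm A.card, h3] at h5
    simp at h5
    omega

end Connectivity
end KL

namespace KL

section Main
set_option linter.unusedSectionVars false
set_option linter.unusedVariables false
variable {V : Type*} [DecidableEq V] {G : SimpleGraph V}

/-- Two-connectivity of the subgraph induced on `S`. -/
def TwoConn (G : SimpleGraph V) (S : Finset V) : Prop :=
  3 ≤ S.card ∧ ∀ w ∈ S, Conn G (S.erase w)

/-- The hypotheses of the main theorem. -/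
structure Hyp (d : ℕ) (G : SimpleGraph V) (S : Finset V) (x y : V) : Prop where
  tc : TwoConn G S
  hx : x ∈ S
  hy : y ∈ S
  adj : G.Adj x y
  path : ∀ l, PathIn G S l → l.head? = some x → l.getLast? = some y → l.length ≤ d + 2

lemma PathIn.rev {S : Finset V} {l : List V} (h : PathIn G S l) : PathIn G S l.reverse :=
  ⟨List.nodup_reverse.2 h.1, chain_rev.2 h.2.1, fun a ha => h.2.2 a (List.mem_reverse.1 ha)⟩

lemma Hyp.symm {d : ℕ} {S : Finset V} {x y : V} (h : Hyp d G S x y) : Hyp d G S y x :=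
  ⟨h.tc, h.hy, h.hx, h.adj.symm, fun l hl h1 h2 => by
    have := h.path l.reverse hl.rev (by simpa using h2) (by simpa using h1)
    simpa using this⟩

lemma side_conn {S K : Finset V} {x x' : V} (h : TwoConn G S) (hx : x ∈ S) (hx' : x' ∈ S)
    (hadj : G.Adj x x') (hK : K ⊆ (S.erase x).erase x') (hne : K.Nonempty)
    (hno : ∀ a ∈ K, ∀ b ∈ (S.erase x).erase x' \ K, ¬ G.Adj a b) :
    TwoConn G (insert x (insert x' K)) := by
  have hxK : x ∉ K := fun h => by simpa using hK h
  have hx'K : x' ∉ K := fun h => by simpa using hK h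
  have hKS : K ⊆ S := hK.trans ((Finset.erase_subset _ _).trans (Finset.erase_subset _ _))
  have hPS : insert x (insert x' K) ⊆ S := by
    intro a ha
    simp only [Finset.mem_insert] at ha
    rcases ha with rfl | rfl | ha
    · exact hx
    · exact hx'
    · exact hKS ha
  refine ⟨?_, ?_⟩
  · rw [Finset.card_insert_of_notMem (by simp [hxK, hadj.ne]), Finset.card_insert_of_notMem hx'K]
    have := Finset.card_pos.2 hne
    omega
  intro w hw
  have core : ∀ A ⊆ K, A.Nonempty → w ∉ A → (S.erase w \ A).Nonempty →
      ∃ a ∈ A, ∃ b ∈ (insert x (insert x' K)).erase w \ A, G.Adj a b := by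
    intro A hA hAne hwA hne2
    obtain ⟨a, ha, b, hb, hab⟩ := h.2 w (hPS hw) A
      (fun a ha => Finset.mem_erase.2 ⟨by rintro rfl; exact hwA ha, hKS (hA ha)⟩) hAne hne2
    refine ⟨a, ha, b, ?_, hab⟩
    simp only [Finset.mem_sdiff, Finset.mem_erase] at hb
    simp only [Finset.mem_sdiff, Finset.mem_erase, Finset.mem_insert]
    refine ⟨⟨hb.1.1, ?_⟩, hb.2⟩
    by_contra hcon
    push Not at hcon
    exact hno a (hA ha) b (by simp [hcon, hb.1.2]) hab
  by_cases hwx : w = x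
  · subst hwx
    apply conn_of_root (r := x') (by simp [hadj.ne'])
    intro A hA hAne hrA
    refine core A ?_ hAne ?_ ⟨x', by simp [hadj.ne', hx', hrA]⟩
    · intro a ha
      have := hA ha
      simp only [Finset.mem_erase, Finset.mem_insert] at this
      rcases this.2 with h | h | h
      · exact absurd h this.1
      · subst h; exact absurd ha hrA
      · exact h
    · intro hwA; simpa using hA hwA
  · apply conn_of_root (r := x) (by simp [Ne.symm hwx])
    intro A hA hAne hrA
    by_cases hx'A : x' ∈ A
    · exact ⟨x', hx'A, x, by simp [Ne.symm hwx, hrA], hadj.symm⟩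
    refine core A ?_ hAne ?_ ⟨x, by simp [Ne.symm hwx, hx, hrA]⟩
    · intro a ha
      have := hA ha
      simp only [Finset.mem_erase, Finset.mem_insert] at this
      rcases this.2 with h | h | h
      · subst h; exact absurd ha hrA
      · subst h; exact absurd ha hx'A
      · exact h
    · intro hwA; simpa using hA hwA

lemma step_cut {d s : ℕ} (hd : 1 ≤ d) {S : Finset V} {x y x' : V} (h : Hyp d G S x y)
    (ih : ∀ (S' : Finset V), S'.card < S.card → ∀ (G : SimpleGraph V) (x y : V), Hyp d G S' x y →
      nc G s S' ≤ gf 2 d s (S'.card - 2))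
    (hx' : x' ∈ S) (hadj : G.Adj x x') (hx'y : x' ≠ y) (hc : ¬ Conn G ((S.erase x).erase x')) :
    nc G s S ≤ gf 2 d s (S.card - 2) := by
  have hxy : x ≠ y := h.adj.ne
  set T := (S.erase x).erase x' with hT
  have hyT : y ∈ T := by simp [hT, Ne.symm hx'y, Ne.symm hxy, h.hy]
  obtain ⟨K, hKT, hKne, hyK, hno⟩ : ∃ K ⊆ T, K.Nonempty ∧ y ∉ K ∧
      ∀ a ∈ K, ∀ b ∈ T \ K, ¬ G.Adj a b := by
    unfold Conn at hc
    push Not at hc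
    obtain ⟨A, hA, hne, hne', hno⟩ := hc
    by_cases hyA : y ∈ A
    · refine ⟨T \ A, Finset.sdiff_subset, hne', by simp [hyA], ?_⟩
      intro a ha b hb hab
      rw [Finset.sdiff_sdiff_eq_self hA] at hb
      exact hno b hb a ha hab.symm
    · exact ⟨A, hA, hne, hyA, hno⟩
  set L := T \ K with hL
  have hyL : y ∈ L := by simp [hL, hyT, hyK]
  have hLT : L ⊆ T := Finset.sdiff_subset
  have hTL : T \ L = K := Finset.sdiff_sdiff_eq_self hKT
  have hxT : x ∉ T := by simp [hT]
  have hx'T : x' ∉ T := by simp [hT]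
  have tcP := side_conn h.tc h.hx hx' hadj hKT hKne hno
  have tcQ := side_conn h.tc h.hx hx' hadj hLT ⟨y, hyL⟩ (by
    intro a ha b hb hab
    rw [← hT, hTL] at hb
    exact hno b hb a ha hab.symm)
  set P := insert x (insert x' K) with hP
  set Q := insert x (insert x' L) with hQ
  have cT : T.card + 2 = S.card := by
    have h1 := Finset.card_erase_add_one h.hx
    have h2 := Finset.card_erase_add_one (s := S.erase x) (a := x') (by simp [hadj.ne', hx'])
    rw [← hT] at h2
    omega
  have cKL : L.card + K.card = T.card := Finset.card_sdiff_add_card_eq_card hKT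
  have cP : P.card = K.card + 2 := by
    rw [hP, Finset.card_insert_of_notMem, Finset.card_insert_of_notMem (fun h => hx'T (hKT h))]
    simp only [Finset.mem_insert, not_or]
    exact ⟨hadj.ne, fun h => hxT (hKT h)⟩
  have cQ : Q.card = L.card + 2 := by
    rw [hQ, Finset.card_insert_of_notMem, Finset.card_insert_of_notMem (fun h => hx'T (hLT h))]
    simp only [Finset.mem_insert, not_or]
    exact ⟨hadj.ne, fun h => hxT (hLT h)⟩
  have hTS : T ⊆ S := (Finset.erase_subset _ _).trans (Finset.erase_subset _ _)
  have hPS : P ⊆ S := Finset.insert_subset h.hx (Finset.insert_subset hx' (hKT.trans hTS))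
  have hQS : Q ⊆ S := Finset.insert_subset h.hx (Finset.insert_subset hx' (hLT.trans hTS))
  have pK := Finset.card_pos.2 hKne
  have pL := Finset.card_pos.2 ⟨y, hyL⟩
  have iQ := ih Q (by omega) G x y ⟨tcQ, by simp [hQ], by simp [hQ, hyL], h.adj,
    fun l hl => h.path l (hl.mono hQS)⟩
  have iP := ih P (by omega) G x x' ⟨tcP, by simp [hP], by simp [hP], hadj, by
    intro l hl hl1 hl2
    obtain ⟨l2, hl2p, h21, h22⟩ := conn_path (tcQ.2 x (by simp [hQ])) (a := x') (b := y)
      (by simp [hQ, hadj.ne']) (by simp [hQ, hyL, Ne.symm hxy])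
    rcases l2 with _ | ⟨c, l2⟩
    · simp at h21
    simp only [List.head?_cons, Option.some.injEq] at h21
    subst h21
    have hl2L : ∀ a ∈ l2, a ∈ L := by
      intro a ha
      have h1 := hl2p.2.2 a (by simp [ha])
      simp only [hQ, Finset.mem_erase, Finset.mem_insert] at h1
      rcases h1.2 with h' | h' | h'
      · exact absurd h' h1.1
      · subst h'; exact absurd ha (List.nodup_cons.1 hl2p.1).1
      · exact h'
    have hl2ne : l2 ≠ [] := by
      rintro rfl; simp at h22; exact hx'y h22
    have := h.path (l ++ l2) ⟨?_, ?_, ?_⟩ ?_ ?_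
    · simp at this; omega
    · rw [List.nodup_append]
      refine ⟨hl.1, (List.nodup_cons.1 hl2p.1).2, ?_⟩
      rintro a ha b hb rfl
      have h1 := hl.2.2 a ha
      have h2 := hl2L a hb
      simp only [hP, Finset.mem_insert] at h1
      rcases h1 with h' | h' | h'
      · subst h'; exact hxT (hLT h2)
      · subst h'; exact hx'T (hLT h2)
      · exact (Finset.mem_sdiff.1 h2).2 h'
    · rw [List.isChain_append]
      have := List.isChain_cons.1 hl2p.2.1
      refine ⟨hl.2.1, this.2, ?_⟩
      intro a ha b hb
      rw [hl2] at ha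
      simp at ha; subst ha
      exact this.1 b hb
    · intro a ha
      rcases List.mem_append.1 ha with ha | ha
      · exact hPS (hl.2.2 a ha)
      · exact hTS (hLT (hl2L a ha))
    · rw [List.head?_append_of_ne_nil _ (by rintro rfl; simp at hl1)]; exact hl1
    · rw [List.getLast?_cons] at h22
      rw [List.getLast?_append, List.getLast?_eq_getLast_of_ne_nil hl2ne]
      rw [List.getLast?_eq_getLast_of_ne_nil hl2ne] at h22
      simpa using h22⟩
  have hU : P ∪ Q = S := by
    apply Finset.Subset.antisymm (Finset.union_subset hPS hQS)
    intro a ha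
    simp only [hP, hQ, hL, hT, Finset.mem_union, Finset.mem_insert, Finset.mem_sdiff, Finset.mem_erase]
    tauto
  have hI : P ∩ Q = {x, x'} := by
    ext a
    simp only [hP, hQ, hL, Finset.mem_inter, Finset.mem_insert, Finset.mem_sdiff, Finset.mem_singleton]
    tauto
  have hun := nc_union (G := G) (j := s) (P := P) (Q := Q) (by
    intro a ha haQ b hb hbP
    simp only [hP, hQ, Finset.mem_insert, not_or] at ha hb haQ hbP
    exact hno a (by tauto) b (by tauto))
  have hcl : G.IsClique (({x, x'} : Finset V) : Set V) := by
    simp [SimpleGraph.isClique_pair, hadj]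
  rw [hU, hI, nc_clique hcl, Finset.card_pair hadj.ne] at hun
  have hg := gf_super 2 d s K.card L.card hd
  rw [show P.card - 2 = K.card by omega] at iP
  rw [show Q.card - 2 = L.card by omega] at iQ
  rw [show S.card - 2 = K.card + L.card by omega]
  omega

open Classical in
/-- Degree inside `S`. -/
noncomputable def dg (G : SimpleGraph V) (S : Finset V) (x : V) : ℕ :=
  (S.filter (fun w => G.Adj x w)).card

lemma kel_conn' {T : Finset V} {u v : V} (hu : u ∉ T) (h : Conn G T) : Conn (kel G u v) T := by
  intro A hA h1 h2
  obtain ⟨a, ha, b, hb, hab⟩ := h A hA h1 h2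
  exact ⟨a, ha, b, hb, kel_of_ne hab (by rintro rfl; exact hu (hA ha))
    (by rintro rfl; exact hu (Finset.mem_sdiff.1 hb).1)⟩

lemma gf_one {d s : ℕ} (hd : 1 ≤ d) (m : ℕ) :
    gf 2 d (s+2) m + Nat.choose 1 (s+1) ≤ gf 2 d (s+2) (m+1) := by
  have h1 := gf_super 2 d (s+2) m 1 hd
  have h2 := gf_small 2 d (s+2) 1 hd hd
  have h3 := Nat.choose_succ_succ' 2 (s+1)
  have h4 : Nat.choose 1 (s+1) ≤ Nat.choose 2 (s+1) := Nat.choose_le_choose _ (by omega)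
  rw [show s + 1 + 1 = s + 2 by rfl, show 2 + 1 = 3 by rfl] at h3
  rw [show 1 + 2 = 3 by rfl] at h2
  omega

lemma step_shift {d s : ℕ} (hd : 1 ≤ d) {S : Finset V} {x y x' z : V} (h : Hyp d G S x y)
    (ih : ∀ (S' : Finset V), S'.card < S.card → ∀ (G : SimpleGraph V) (x y : V), Hyp d G S' x y →
      nc G (s+2) S' ≤ gf 2 d (s+2) (S'.card - 2))
    (hx' : x' ∈ S) (hadj : G.Adj x x') (hx'y : x' ≠ y) (hc : Conn G ((S.erase x).erase x'))
    (hz : z ∈ S) (hzx' : G.Adj x' z) (hzx : z ≠ x) (hxz : ¬ G.Adj x z) :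
    nc G (s+2) S ≤ gf 2 d (s+2) (S.card - 2) ∨ ∃ G' : SimpleGraph V, Hyp d G' S x y ∧
      nc G (s+2) S ≤ nc G' (s+2) S ∧ dg G S x < dg G' S x ∧ dg G S y ≤ dg G' S y := by
  classical
  have hxy : x ≠ y := h.adj.ne
  have huv : G.Adj x' x := hadj.symm
  have hpath : ∀ l, PathIn (kel G x' x) S l → l.head? = some x → l.getLast? = some y →
      l.length ≤ d + 2 := by
    intro l hl h1 h2
    obtain ⟨l', hl', hle, h3, h4⟩ := kel_pathIn huv hx' hl
    have := h.path l' hl' (by rw [h3 (by rw [h1]; simpa using hadj.ne), h1])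
      (by rw [h4 (by rw [h2]; simpa using Ne.symm hx'y), h2])
    omega
  have hnc : nc G (s+2) S ≤ nc (kel G x' x) (s+2) S := nc_kel huv h.hx
  have hadj' : (kel G x' x).Adj x y := kel_of_v huv h.adj
  have hT : Conn (kel G x' x) ((S.erase x).erase x') := kel_conn' (by simp) hc
  by_cases hcom : ∃ c ∈ S, G.Adj x c ∧ G.Adj x' c
  · right
    obtain ⟨c, hcS, hxc, hx'c⟩ := hcom
    refine ⟨kel G x' x, ⟨⟨h.tc.1, ?_⟩, h.hx, h.hy, hadj', hpath⟩, hnc, ?_, ?_⟩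
    · intro w hw
      by_cases hwx : w = x
      · subst hwx
        apply conn_of_root (r := c) (by simp [hcS, hxc.ne'])
        intro A hA hne hcA
        by_cases hx'A : x' ∈ A
        · exact ⟨x', hx'A, c, by simp [hcS, hxc.ne', hcA], kel_of_common huv hx'c hxc⟩
        · obtain ⟨a, ha, b, hb, hab⟩ := hT A (fun a ha => Finset.mem_erase.2
            ⟨by rintro rfl; exact hx'A ha, hA ha⟩) hne ⟨c, by simp [hcS, hxc.ne', hx'c.ne', hcA]⟩
          refine ⟨a, ha, b, ?_, hab⟩
          simp only [Finset.mem_sdiff, Finset.mem_erase] at hb ⊢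
          tauto
      · by_cases hwx' : w = x'
        · subst hwx'
          exact kel_conn' (by simp) (h.tc.2 w hw)
        · exact kel_conn huv (by simp [Ne.symm hwx, h.hx]) (h.tc.2 w hw)
    · apply Finset.card_lt_card
      rw [Finset.ssubset_iff]
      refine ⟨z, by simp [hxz], ?_⟩
      intro w hw
      rcases Finset.mem_insert.1 hw with rfl | hw
      · exact Finset.mem_filter.2 ⟨hz, kel_of_u hzx hzx'⟩
      · rw [Finset.mem_filter] at hw ⊢
        exact ⟨hw.1, kel_of_v huv hw.2⟩
    · apply Finset.card_le_card
      intro w hw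
      rw [Finset.mem_filter] at hw ⊢
      refine ⟨hw.1, ?_⟩
      by_cases hwx' : w = x'
      · subst hwx'
        exact (kel_of_common huv hw.2.symm h.adj).symm
      · exact kel_of_ne hw.2 (Ne.symm hx'y) hwx'
  · left
    push Not at hcom
    have hx'nb : ∀ w ∈ S, (kel G x' x).Adj x' w → w = x := by
      intro w hw haw
      obtain ⟨h1, h2⟩ := kel_u huv haw
      exact h2.resolve_right (fun h3 => hcom w hw h3 h1)
    have c1 := Finset.card_erase_add_one hx'
    have c4 : 4 ≤ S.card := by
      have hzy : z ≠ y := by rintro rfl; exact hxz h.adj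
      have h5 : ({x, x', y, z} : Finset V) ⊆ S := by
        intro a ha
        simp only [Finset.mem_insert, Finset.mem_singleton] at ha
        rcases ha with rfl | rfl | rfl | rfl
        · exact h.hx
        · exact hx'
        · exact h.hy
        · exact hz
      have h6 := Finset.card_le_card h5
      rw [Finset.card_insert_of_notMem (by simp [hadj.ne, hxy, Ne.symm hzx]),
        Finset.card_insert_of_notMem (by simp [hx'y, hzx'.ne]),
        Finset.card_pair (Ne.symm hzy)] at h6
      omega
    have key := ih (S.erase x') (by omega) (kel G x' x) x y ⟨⟨by omega, ?_⟩,
      by simp [hadj.ne, h.hx], by simp [Ne.symm hx'y, h.hy], hadj',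
      fun l hl => hpath l (hl.mono (Finset.erase_subset _ _))⟩
    · have h1 := nc_split (G := kel G x' x) (j := s+1) (S := S) (T := {x}) (u := x')
        (fun w hw haw => Finset.mem_singleton.2 (hx'nb w hw haw))
      have h2 := nc_le (G := kel G x' x) (s+1) {x}
      rw [Finset.card_singleton] at h2
      have h3 := gf_one (s := s) hd ((S.erase x').card - 2)
      rw [show (S.erase x').card - 2 + 1 = S.card - 2 by omega] at h3
      rw [show s + 1 + 1 = s + 2 by rfl] at h1
      omega
    · intro w hw
      rw [Finset.mem_erase] at hw
      by_cases hwx : w = x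
      · subst hwx
        rwa [Finset.erase_right_comm]
      · apply conn_of_root (r := x) (by simp [hadj.ne, Ne.symm hwx, h.hx])
        intro A hA hne hxA
        obtain ⟨a, ha, b, hb, hab⟩ := kel_conn huv (T := S.erase w) (by simp [Ne.symm hwx, h.hx])
          (h.tc.2 w hw.2) A (fun a ha => by
            have := hA ha
            simp only [Finset.mem_erase] at this ⊢
            tauto) hne ⟨x, by simp [Ne.symm hwx, h.hx, hxA]⟩
        refine ⟨a, ha, b, ?_, hab⟩
        have haS := hA ha
        simp only [Finset.mem_sdiff, Finset.mem_erase] at hb haS ⊢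
        refine ⟨⟨hb.1.1, ?_, hb.1.2⟩, hb.2⟩
        rintro rfl
        have := hx'nb a haS.2.2 hab.symm
        subst this
        exact hxA ha

lemma uni_of {d : ℕ} {S : Finset V} {x y : V} (h : Hyp d G S x y)
    (hn : ∀ x' ∈ S, G.Adj x x' → x' ≠ y → ∀ z ∈ S, G.Adj x' z → z ≠ x → G.Adj x z) :
    ∀ w ∈ S, w ≠ x → G.Adj x w := by
  classical
  intro w hw hwx
  by_contra hcon
  have hwy : w ≠ y := by rintro rfl; exact hcon h.adj
  obtain ⟨a, ha, b, hb, hab⟩ := h.tc.2 y h.hy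
    ((S.erase y).filter (fun w => w = x ∨ G.Adj x w)) (Finset.filter_subset _ _)
    ⟨x, by simp [h.hx, h.adj.ne]⟩ ⟨w, by simp [hw, hwy, hwx, hcon]⟩
  simp only [Finset.mem_sdiff, Finset.mem_filter, Finset.mem_erase, not_and, not_or] at ha hb
  have hb2 := hb.2 hb.1
  rcases ha.2 with rfl | ha2
  · exact hb2.2 hab
  · exact hb2.2 (hn a ha.1.2 ha2 ha.1.1 b hb.1.2 hab hb2.1)

lemma case_uni {d s : ℕ} (hd : 1 ≤ d) {S : Finset V} {x y : V} (h : Hyp d G S x y)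
    (hux : ∀ w ∈ S, w ≠ x → G.Adj x w) (huy : ∀ w ∈ S, w ≠ y → G.Adj y w) :
    nc G (s+2) S ≤ gf 2 d (s+2) (S.card - 2) := by
  have hxy := h.adj.ne
  set S0 := (S.erase x).erase y with hS0
  have hS0S : S0 ⊆ S := (Finset.erase_subset _ _).trans (Finset.erase_subset _ _)
  have hp : ∀ l, PathIn G S0 l → l.length ≤ d := by
    intro l hl
    have hxl : x ∉ l := fun h => by simpa [hS0] using hl.2.2 _ h
    have hyl : y ∉ l := fun h => by simpa [hS0] using hl.2.2 _ h
    by_cases hne : l = []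
    · subst hne; simp
    have := h.path (x :: (l ++ [y])) ⟨?_, ?_, ?_⟩ (by simp) ?_
    · simp at this; omega
    · rw [List.nodup_cons, List.nodup_append]
      refine ⟨by simp [hxl, hxy], hl.1, by simp, ?_⟩
      rintro a ha b hb rfl
      simp at hb; subst hb; exact hyl ha
    · rw [List.isChain_cons, List.isChain_append]
      refine ⟨?_, hl.2.1, by simp, ?_⟩
      · intro b hb
        rw [List.head?_append_of_ne_nil _ hne] at hb
        have hb' := List.mem_of_head? hb
        exact hux b (hS0S (hl.2.2 b hb')) (by rintro rfl; exact hxl hb')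
      · intro b hb c hc
        simp at hc; subst hc
        have hb' := List.mem_of_getLast? hb
        exact (huy b (hS0S (hl.2.2 b hb')) (by rintro rfl; exact hyl hb')).symm
    · intro a ha
      simp only [List.mem_cons, List.mem_append, List.not_mem_nil, or_false] at ha
      rcases ha with rfl | ha | rfl
      · exact h.hx
      · exact hS0S (hl.2.2 a ha)
      · exact h.hy
    · simp [List.getLast?_cons]
  have c1 := Finset.card_erase_add_one h.hx
  have c2 := Finset.card_erase_add_one (s := S.erase x) (a := y) (by simp [Ne.symm hxy, h.hy])
  rw [← hS0] at c2
  have hcard : S.card - 2 = S0.card := by omega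
  have hT1 : ∀ w ∈ S, G.Adj x w → w ∈ S.erase x := fun w hw ha => Finset.mem_erase.2 ⟨ha.ne', hw⟩
  have hT2 : ∀ w ∈ S.erase x, G.Adj y w → w ∈ S0 := fun w hw ha => Finset.mem_erase.2 ⟨ha.ne', hw⟩
  have n1 := nc_split (j := s+1) hT1
  have n2 := nc_split (j := s+1) hT2
  have n3 := nc_split (j := s) hT2
  rw [← hS0] at n2 n3
  have p1 := lemmaP d hd G (s+2) _ S0 rfl hp
  have p2 := lemmaP d hd G (s+1) _ S0 rfl hp
  have p3 := lemmaP d hd G s _ S0 rfl hp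
  have e : gf 2 d (s+2) S0.card = gf 0 d (s+2) S0.card + 2 * gf 0 d (s+1) S0.card
      + gf 0 d s S0.card := by
    have pas : ∀ a, Nat.choose (a+2) (s+2) =
        Nat.choose a (s+2) + 2 * Nat.choose a (s+1) + Nat.choose a s := by
      intro a
      have e1 := Nat.choose_succ_succ' (a+1) (s+1)
      have e2 := Nat.choose_succ_succ' a (s+1)
      have e3 := Nat.choose_succ_succ' a s
      rw [show a + 1 + 1 = a + 2 by rfl, show s + 1 + 1 = s + 2 by rfl] at *
      omega
    unfold gf
    rw [pas, pas]
    simp only [add_zero]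
    ring
  rw [hcard, e]
  rw [show s + 1 + 1 = s + 2 by rfl] at n1 n2
  omega

lemma dg_le (G : SimpleGraph V) {S : Finset V} {x : V} (hx : x ∈ S) : dg G S x < S.card := by
  classical
  apply Finset.card_lt_card
  rw [Finset.filter_ssubset]
  exact ⟨x, hx, by simp⟩

theorem main1 {d s : ℕ} (hd : 1 ≤ d) : ∀ (n : ℕ) (S : Finset V), S.card = n →
    ∀ (G : SimpleGraph V) (x y : V), Hyp d G S x y →
    nc G (s+2) S ≤ gf 2 d (s+2) (S.card - 2) := by
  intro n
  induction n using Nat.strong_induction_on with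
  | _ n ih =>
  intro S hS
  have ih' : ∀ (S' : Finset V), S'.card < S.card → ∀ (G : SimpleGraph V) (x y : V),
      Hyp d G S' x y → nc G (s+2) S' ≤ gf 2 d (s+2) (S'.card - 2) :=
    fun S' hS' => ih S'.card (by omega) S' rfl
  have inner : ∀ (m : ℕ) (G : SimpleGraph V) (x y : V), Hyp d G S x y →
      2 * S.card ≤ dg G S x + dg G S y + m → nc G (s+2) S ≤ gf 2 d (s+2) (S.card - 2) := by
    intro m
    induction m with
    | zero =>
      intro G x y h hm
      have h1 := dg_le G h.hx
      have h2 := dg_le G h.hy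
      omega
    | succ m ihm =>
      intro G x y h hm
      have side : ∀ x y : V, Hyp d G S x y → 2 * S.card ≤ dg G S x + dg G S y + (m + 1) →
          nc G (s+2) S ≤ gf 2 d (s+2) (S.card - 2) ∨ ∀ w ∈ S, w ≠ x → G.Adj x w := by
        intro x y h hm
        by_cases hn : ∀ x' ∈ S, G.Adj x x' → x' ≠ y → ∀ z ∈ S, G.Adj x' z → z ≠ x → G.Adj x z
        · exact Or.inr (uni_of h hn)
        · left
          push Not at hn
          obtain ⟨x', hx', hadj, hx'y, z, hz, hzx', hzx, hxz⟩ := hn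
          by_cases hc : Conn G ((S.erase x).erase x')
          · rcases step_shift hd h ih' hx' hadj hx'y hc hz hzx' hzx hxz with h1 | ⟨G', h1, h2, h3, h4⟩
            · exact h1
            · exact h2.trans (ihm G' x y h1 (by omega))
          · exact step_cut hd h ih' hx' hadj hx'y hc
      rcases side x y h hm with h1 | h1
      · exact h1
      rcases side y x h.symm (by omega) with h2 | h2
      · exact h2
      exact case_uni hd h h1 h2
  intro G x y h
  exact inner (2 * S.card) G x y h (by omega)

end Main
end KL

namespace KL
section Final
variable {V : Type*}

lemma reach_cut {W : Type*} {H : SimpleGraph W} (A : Set W) {a b : W} (w : H.Walk a b)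
    (ha : a ∈ A) (hb : b ∉ A) : ∃ c ∈ A, ∃ e, e ∉ A ∧ H.Adj c e := by
  induction w with
  | nil => exact absurd ha hb
  | @cons u v w h p ih =>
    by_cases hv : v ∈ A
    · exact ih hv hb
    · exact ⟨u, ha, v, hv, h⟩

lemma twoConn_univ [Fintype V] [DecidableEq V] {G : SimpleGraph V} (h : TwoConnected G) :
    TwoConn G (Finset.univ : Finset V) := by
  refine ⟨by simpa [Nat.card_eq_fintype_card] using h.1, ?_⟩
  rintro w - A hA ⟨a, ha⟩ ⟨b, hb⟩
  have hb' := Finset.mem_sdiff.1 hb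
  have haw : a ≠ w := (Finset.mem_erase.1 (hA ha)).1
  have hbw : b ≠ w := (Finset.mem_erase.1 hb'.1).1
  obtain ⟨p⟩ := (h.2 w).preconnected ⟨a, haw⟩ ⟨b, hbw⟩
  obtain ⟨c, hc, e, he, hce⟩ := reach_cut {z : {z : V | z ≠ w} | (z : V) ∈ A} p ha hb'.2
  exact ⟨c, hc, e, Finset.mem_sdiff.2 ⟨Finset.mem_erase.2 ⟨e.2, Finset.mem_univ _⟩, he⟩, hce⟩

lemma nc_univ [Fintype V] [DecidableEq V] (G : SimpleGraph V) (s : ℕ) :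
    (G.cliqueSet s).ncard = nc G s (Finset.univ : Finset V) := by
  unfold nc
  rw [← Set.ncard_coe_finset]
  congr 1
  ext A
  simp only [SimpleGraph.mem_cliqueSet_iff, SimpleGraph.isNClique_iff, Finset.mem_coe, mem_ncF]
  simp
  tauto

lemma cycle_of_path {G : SimpleGraph V} {x y : V} (hxy : G.Adj x y) {k : ℕ} (hk : 3 ≤ k)
    (l : List V) (hn : l.Nodup) (hc : l.IsChain G.Adj) (h1 : l.head? = some x)
    (h2 : l.getLast? = some y) (hl : k ≤ l.length) :
    ∃ (a : V) (w : G.Walk a a), w.IsCycle ∧ s(x, y) ∈ w.edges ∧ k ≤ w.length := by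
  have hne : l ≠ [] := by rintro rfl; simp at h1
  have e1 : l.head hne = x := by
    rw [List.head?_eq_some_head hne] at h1; simpa using h1
  have e2 : l.getLast hne = y := by
    rw [List.getLast?_eq_getLast_of_ne_nil hne] at h2; simpa using h2
  obtain ⟨p, hp1, hp2⟩ : ∃ p : G.Walk x y, p.support = l ∧ p.length + 1 = l.length := by
    subst e1 e2
    refine ⟨SimpleGraph.Walk.ofSupport l hne hc, SimpleGraph.Walk.support_ofSupport .., ?_⟩
    rw [← SimpleGraph.Walk.length_support, SimpleGraph.Walk.support_ofSupport]
  have hpp : p.IsPath := by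
    rw [SimpleGraph.Walk.isPath_def, hp1]; exact hn
  refine ⟨y, SimpleGraph.Walk.cons hxy.symm p, ?_, ?_, ?_⟩
  · rw [SimpleGraph.Walk.cons_isCycle_iff]
    refine ⟨hpp, ?_⟩
    intro he
    cases p with
    | nil => exact hxy.ne rfl
    | @cons _ v _ h q =>
      rw [SimpleGraph.Walk.cons_isPath_iff] at hpp
      rw [SimpleGraph.Walk.edges_cons, List.mem_cons] at he
      rcases he with he | he
      · have : v = y := by
          rw [Sym2.eq_iff] at he
          rcases he with he | he
          · exact absurd he.1 hxy.ne'
          · exact he.1.symm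
        subst this
        have := hpp.1
        cases q with
        | nil => simp at hp2; omega
        | cons h' q' =>
          rw [SimpleGraph.Walk.cons_isPath_iff] at this
          exact this.2 (SimpleGraph.Walk.end_mem_support _)
      · exact hpp.2 (SimpleGraph.Walk.snd_mem_support_of_mem_edges _ he)
  · simp [Sym2.eq_swap]
  · simp; omega

end Final
end KL

theorem stmt_14 {V : Type*} [Fintype V] (G : SimpleGraph V) (n k s r t : ℕ)
    (hn : Fintype.card V = n) (hn3 : 3 ≤ n) (hk : 4 ≤ k) (hs : 2 ≤ s)
    (h2c : TwoConnected G)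
    (ht : t ≤ k - 4) (hrt : n - 2 = r * (k - 3) + t)
    (hN : r * Nat.choose (k - 1) s + Nat.choose (t + 2) s < (G.cliqueSet s).ncard) :
    ∀ x y : V, G.Adj x y →
      ∃ (a : V) (w : G.Walk a a), w.IsCycle ∧ s(x, y) ∈ w.edges ∧ k ≤ w.length := by
  classical
  intro x y hxy
  by_contra hcon
  obtain ⟨d, rfl⟩ : ∃ d, k = d + 3 := ⟨k - 3, by omega⟩
  obtain ⟨s, rfl⟩ : ∃ j, s = j + 2 := ⟨s - 2, by omega⟩
  have hd : 1 ≤ d := by omega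
  have hyp : KL.Hyp d G (Finset.univ : Finset V) x y := by
    refine ⟨KL.twoConn_univ h2c, Finset.mem_univ _, Finset.mem_univ _, hxy, ?_⟩
    intro l hl h1 h2
    by_contra hlen
    exact hcon (KL.cycle_of_path hxy (by omega) l hl.1 hl.2.1 h1 h2 (by omega))
  have := KL.main1 (s := s) hd _ _ rfl G x y hyp
  rw [Finset.card_univ, hn, hrt, ← KL.nc_univ] at this
  unfold KL.gf at this
  have e3 : d + 3 - 3 = d := by omega
  have htd : t < d := by omega
  have q1 : (r * d + t) / d = r := by
    rw [mul_comm, Nat.mul_add_div (by omega), Nat.div_eq_of_lt htd, add_zero]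
  have q2 : (r * d + t) % d = t := by
    rw [mul_comm, Nat.mul_add_mod, Nat.mod_eq_of_lt htd]
  rw [e3, q1, q2] at this
  rw [show d + 3 - 1 = d + 2 by omega] at hN
  omega
end

section
/- Let G be a 2-connected graph with a vertex cut {x, y} such that xy is an edge of G, let H be a connected component of G - {x,y}, and set G1 = G[V(H) ∪ {x,y}] and G2 = G - V(H). Then both G1 and G2 are 2-connected, and for every s ≥ 3, N_s(G) = N_s(G1) + N_s(G2). -/
/-- `{u, v}` is a vertex cut of `G`: `G - {u,v}` is disconnected. -/
def IsCutPair {V : Type*} (G : SimpleGraph V) (u v : V) : Prop :=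
  ¬ (G.induce {w : V | w ≠ u ∧ w ≠ v}).Connected

theorem reach_fold {V W : Type*} {G : SimpleGraph V} {K : SimpleGraph W} (f : V → W)
    (hf : ∀ u w, G.Adj u w → K.Reachable (f u) (f w)) {a b : V} (h : G.Reachable a b) :
    K.Reachable (f a) (f b) := by
  obtain ⟨p⟩ := h
  induction p with
  | nil => exact SimpleGraph.Reachable.refl _
  | cons h _ ih => exact (hf _ _ h).trans ih

theorem twoConn_side {V : Type*} [Fintype V] (G : SimpleGraph V) (x y : V) (A : Set V)
    (h2c : TwoConnected G) (hxy : G.Adj x y) (hx : x ∈ A) (hy : y ∈ A)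
    (z : V) (hz : z ∈ A) (hzx : z ≠ x) (hzy : z ≠ y)
    (hA : ∀ u w, G.Adj u w → u ∈ A → w ∉ A → u = x ∨ u = y) :
    TwoConnected (G.induce A) := by
  classical
  refine ⟨?_, ?_⟩
  · have h1 : ({x, y, z} : Set V) ⊆ A := by
      intro w hw
      simp only [Set.mem_insert_iff, Set.mem_singleton_iff] at hw
      rcases hw with rfl | rfl | rfl <;> assumption
    have h3 : ({x, y, z} : Set V).ncard = 3 :=
      Set.ncard_eq_three.2 ⟨x, y, z, hxy.ne, hzx.symm, hzy.symm, rfl⟩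
    have := Set.ncard_le_ncard h1 (Set.toFinite A)
    rw [h3] at this
    exact this
  · rintro ⟨v, hv⟩
    obtain ⟨p, hpA, hpv, hp⟩ : ∃ p, p ∈ A ∧ p ≠ v ∧ (p = x ∨ p = y) := by
      by_cases h : x = v
      · exact ⟨y, hy, fun h' => hxy.ne (h.trans h'.symm), Or.inr rfl⟩
      · exact ⟨x, hx, h, Or.inl rfl⟩
    have hpa : ∀ u, (u = x ∨ u = y) → u = p ∨ G.Adj u p := by
      rintro u (rfl | rfl) <;> rcases hp with rfl | rfl <;> simp [hxy, hxy.symm]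
    let P : {w : A | w ≠ ⟨v, hv⟩} := ⟨⟨p, hpA⟩, fun h => hpv (congrArg Subtype.val h)⟩
    let f : {w : V | w ≠ v} → {w : A | w ≠ ⟨v, hv⟩} := fun u =>
      if h : u.1 ∈ A then ⟨⟨u.1, h⟩, fun h' => u.2 (congrArg Subtype.val h')⟩ else P
    have hf1 : ∀ u (h : u.1 ∈ A), f u = ⟨⟨u.1, h⟩, fun h' => u.2 (congrArg Subtype.val h')⟩ :=
      fun u h => dif_pos h
    have hf2 : ∀ u, u.1 ∉ A → f u = P := fun u h => dif_neg h
    let K := (G.induce A).induce {w : A | w ≠ ⟨v, hv⟩}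
    have key : ∀ u w : {w : V | w ≠ v}, G.Adj u.1 w.1 → u.1 ∈ A → w.1 ∉ A →
        K.Reachable (f u) (f w) := by
      intro u w h hu hw
      rw [hf2 w hw, hf1 u hu]
      rcases hpa _ (hA _ _ h hu hw) with h' | h'
      · have : (⟨⟨u.1, hu⟩, fun h' => u.2 (congrArg Subtype.val h')⟩ :
            {w : A | w ≠ ⟨v, hv⟩}) = P := Subtype.ext (Subtype.ext h')
        rw [this]
      · exact SimpleGraph.Adj.reachable (G := K) h'
    have hf : ∀ u w, (G.induce {w : V | w ≠ v}).Adj u w → K.Reachable (f u) (f w) := by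
      intro u w h
      have h : G.Adj u.1 w.1 := h
      by_cases hu : u.1 ∈ A <;> by_cases hw : w.1 ∈ A
      · rw [hf1 u hu, hf1 w hw]
        exact SimpleGraph.Adj.reachable (G := K) h
      · exact key u w h hu hw
      · exact (key w u h.symm hw hu).symm
      · rw [hf2 u hu, hf2 w hw]
    have hc := h2c.2 v
    refine SimpleGraph.connected_iff _ |>.2 ⟨?_, ⟨P⟩⟩
    rintro ⟨⟨a, haA⟩, ha⟩ ⟨⟨b, hbA⟩, hb⟩
    have ha' : a ≠ v := fun h => ha (Subtype.ext h)
    have hb' : b ≠ v := fun h => hb (Subtype.ext h)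
    have := reach_fold f hf (hc.preconnected ⟨a, ha'⟩ ⟨b, hb'⟩)
    rwa [hf1 _ haA, hf1 _ hbA] at this

theorem ncard_induce_cliqueSet {V : Type*} (G : SimpleGraph V) (A : Set V) (s : ℕ) :
    ((G.induce A).cliqueSet s).ncard = {t ∈ G.cliqueSet s | (t : Set V) ⊆ A}.ncard := by
  classical
  rw [← Set.ncard_image_of_injective _ (Finset.map_injective (Function.Embedding.subtype (· ∈ A)))]
  congr 1
  ext t
  simp only [Set.mem_image, SimpleGraph.mem_cliqueSet_iff, SimpleGraph.isNClique_iff,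
    SimpleGraph.isClique_iff, Set.mem_ofPred_eq]
  constructor
  · rintro ⟨r, ⟨h1, h2⟩, rfl⟩
    refine ⟨⟨?_, by simpa using h2⟩, ?_⟩
    · intro a ha b hb hab
      simp only [Finset.coe_map, Set.mem_image] at ha hb
      obtain ⟨a, ha, rfl⟩ := ha
      obtain ⟨b, hb, rfl⟩ := hb
      exact h1 ha hb (fun h => hab (by rw [h]))
    · intro a ha
      simp only [Finset.coe_map, Set.mem_image] at ha
      obtain ⟨a, ha, rfl⟩ := ha
      exact a.2
  · rintro ⟨⟨h1, h2⟩, h3⟩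
    have hm : (t.subtype (· ∈ A)).map (Function.Embedding.subtype (· ∈ A)) = t :=
      Finset.subtype_map_of_mem h3
    refine ⟨t.subtype (· ∈ A), ⟨?_, ?_⟩, hm⟩
    · intro a ha b hb hab
      simp only [Finset.mem_coe, Finset.mem_subtype] at ha hb
      exact h1 ha hb (fun h => hab (Subtype.ext h))
    · rw [← h2, ← hm, Finset.card_map, hm]

theorem stmt_19 {V : Type*} [Fintype V] (G : SimpleGraph V) (x y : V)
    (H : Set V) (s : ℕ) (hs : 3 ≤ s)
    (h2c : TwoConnected G) (hxy : G.Adj x y) (hcut : IsCutPair G x y)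
    (hH : ∃ c : (G.induce {w : V | w ≠ x ∧ w ≠ y}).ConnectedComponent,
        H = Subtype.val '' c.supp) :
    TwoConnected (G.induce (H ∪ {x, y})) ∧ TwoConnected (G.induce Hᶜ) ∧
      (G.cliqueSet s).ncard
        = ((G.induce (H ∪ {x, y})).cliqueSet s).ncard
          + ((G.induce Hᶜ).cliqueSet s).ncard := by
  classical
  obtain ⟨c, hc⟩ := hH
  have hHx : x ∉ H := by
    rw [hc]; rintro ⟨a, -, h⟩; exact a.2.1 h
  have hHy : y ∉ H := by
    rw [hc]; rintro ⟨a, -, h⟩; exact a.2.2 h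
  have hadj : ∀ u w, G.Adj u w → u ∈ H → w ∈ H ∪ {x, y} := by
    intro u w h hu
    by_cases hw : w ≠ x ∧ w ≠ y
    · left
      rw [hc] at hu ⊢
      obtain ⟨u, hu, rfl⟩ := hu
      refine ⟨⟨w, hw⟩, ?_, rfl⟩
      rw [SimpleGraph.ConnectedComponent.mem_supp_iff] at hu ⊢
      rw [← hu]
      refine SimpleGraph.ConnectedComponent.sound (SimpleGraph.Adj.reachable ?_)
      exact h.symm
    · right
      simp only [Set.mem_insert_iff, Set.mem_singleton_iff]
      tauto
  obtain ⟨z, hz⟩ : ∃ z, z ∈ H := by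
    obtain ⟨a, ha⟩ := c.nonempty_supp
    exact ⟨a.1, by rw [hc]; exact ⟨a, ha, rfl⟩⟩
  obtain ⟨z', hz', hzx', hzy'⟩ : ∃ z', z' ∉ H ∧ z' ≠ x ∧ z' ≠ y := by
    by_contra hcon
    push Not at hcon
    apply hcut
    obtain ⟨a, ha⟩ := c.nonempty_supp
    have hall : ∀ w, w ∈ c.supp := by
      intro w
      by_contra hw
      refine w.2.2 (hcon w.1 ?_ w.2.1)
      rw [hc]
      rintro ⟨b, hb, h⟩
      rw [Subtype.ext h] at hb
      exact hw hb
    refine SimpleGraph.connected_iff _ |>.2 ⟨?_, ⟨a⟩⟩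
    intro p q
    exact SimpleGraph.ConnectedComponent.exact ((hall p).trans (hall q).symm)
  refine ⟨?_, ?_, ?_⟩
  · refine twoConn_side G x y _ h2c hxy (by simp) (by simp) z (Or.inl hz)
      (fun h => hHx (h ▸ hz)) (fun h => hHy (h ▸ hz)) ?_
    rintro u w h (hu | hu) hw
    · exact absurd (hadj u w h hu) hw
    · exact hu
  · refine twoConn_side G x y _ h2c hxy hHx hHy z' hz' hzx' hzy' ?_
    intro u w h hu hw
    rcases hadj w u h.symm (not_not.1 hw) with h' | h'
    · exact absurd h' hu
    · exact h'
  · rw [ncard_induce_cliqueSet, ncard_induce_cliqueSet, ← Set.ncard_union_eq]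
    · congr 1
      ext t
      simp only [Set.mem_union, Set.mem_ofPred_eq, ← and_or_left]
      refine ⟨fun ht => ⟨ht, ?_⟩, fun ht => ht.1⟩
      by_cases hd : ∃ a ∈ t, a ∈ H
      · left
        obtain ⟨a, hat, haH⟩ := hd
        intro b hb
        by_cases hab : a = b
        · exact Or.inl (hab ▸ haH)
        · exact hadj a b (ht.1 hat hb hab) haH
      · right
        intro b hb hbH
        exact hd ⟨b, hb, hbH⟩
    · rw [Set.disjoint_left]
      rintro t ⟨ht, h1⟩ ⟨-, h2⟩
      have hsub : t ⊆ {x, y} := by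
        intro a ha
        rcases h1 ha with h | h
        · exact absurd h (h2 ha)
        · simpa using h
      have h3 := Finset.card_le_card hsub
      have h4 : ({x, y} : Finset V).card ≤ 2 := Finset.card_le_two
      have h5 : t.card = s := ht.2
      omega
end
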